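/- arXiv:0804.4789 — 3 statements merged into one kernel-verified Lean document; each statement's English description precedes it below -/
import Mathlib

section
/- Let g ≥ 2 and let d ≥ 2 be even. Then Γ_g[d²,2d²] ⊆ [Γ_g[d],Γ_g[d]]. -/
open Matrix

/-- The index type for `2g × 2g` matrices, written as `Fin g ⊕ Fin g`. -/
abbrev Idx (g : ℕ) := Fin g ⊕ Fin g

/-- The integral symplectic group `Sp(2g; ℤ)`. -/
abbrev SpZ (g : ℕ) := Matrix.symplecticGroup (Fin g) ℤ

/-- Entrywise reduction of integral matrices mod `d`. -/
def modred (g d : ℕ) : Matrix (Idx g) (Idx g) ℤ →+* Matrix (Idx g) (Idx g) (ZMod d) :=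
  (Int.castRingHom (ZMod d)).mapMatrix

/-- The level `d` congruence subgroup `Γ_g[d]` of `Sp(2g; ℤ)`:
matrices congruent to the identity mod `d`. -/
def Gamma (g d : ℕ) : Subgroup ↥(SpZ g) where
  carrier := {A | modred g d (A : Matrix (Idx g) (Idx g) ℤ) = 1}
  one_mem' := by
    simp [Set.mem_setOf_eq]
  mul_mem' := by
    intro a b ha hb
    simp only [Set.mem_setOf_eq, Submonoid.coe_mul, _root_.map_mul] at *
    rw [ha, hb, one_mul]
  inv_mem' := by
    intro a ha
    simp only [Set.mem_setOf_eq] at *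
    have h : modred g d ((a⁻¹ : ↥(SpZ g)) : Matrix (Idx g) (Idx g) ℤ) *
        modred g d ((a : ↥(SpZ g)) : Matrix (Idx g) (Idx g) ℤ) = 1 := by
      rw [← _root_.map_mul, ← Submonoid.coe_mul, inv_mul_cancel, Submonoid.coe_one, _root_.map_one]
    calc modred g d ((a⁻¹ : ↥(SpZ g)) : Matrix (Idx g) (Idx g) ℤ)
        = modred g d ((a⁻¹ : ↥(SpZ g)) : Matrix (Idx g) (Idx g) ℤ) *
            modred g d ((a : ↥(SpZ g)) : Matrix (Idx g) (Idx g) ℤ) := by rw [ha, mul_one]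
      _ = 1 := h

lemma mem_Gamma_iff {g d : ℕ} {A : ↥(SpZ g)} :
    A ∈ Gamma g d ↔ ∀ i j : Idx g, (d : ℤ) ∣
      ((A : Matrix (Idx g) (Idx g) ℤ) i j - (1 : Matrix (Idx g) (Idx g) ℤ) i j) := by
  have : A ∈ Gamma g d ↔ modred g d (A : Matrix (Idx g) (Idx g) ℤ) = 1 := Iff.rfl
  rw [this, ← Matrix.ext_iff]
  constructor
  · intro h i j
    have hij := h i j
    simp only [modred, RingHom.mapMatrix_apply, Matrix.map_apply, Int.coe_castRingHom] at hij
    have h1 : ((1 : Matrix (Idx g) (Idx g) ℤ) i j : ZMod d) = (1 : Matrix (Idx g) (Idx g) (ZMod d)) i j := by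
      by_cases hij' : i = j <;> simp [Matrix.one_apply, hij']
    rw [← h1] at hij
    rw [← ZMod.intCast_zmod_eq_zero_iff_dvd]
    push_cast
    rw [hij]
    ring
  · intro h i j
    have hij := h i j
    rw [← ZMod.intCast_zmod_eq_zero_iff_dvd] at hij
    push_cast at hij
    simp only [modred, RingHom.mapMatrix_apply, Matrix.map_apply, Int.coe_castRingHom]
    have h1 : ((1 : Matrix (Idx g) (Idx g) ℤ) i j : ZMod d) = (1 : Matrix (Idx g) (Idx g) (ZMod d)) i j := by
      by_cases hij' : i = j <;> simp [Matrix.one_apply, hij']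
    rw [← h1]
    linear_combination hij
lemma Gamma_entry_dvd {g d : ℕ} {A : ↥(SpZ g)} (hA : A ∈ Gamma g d) {i j : Idx g}
    (hij : i ≠ j) : (d : ℤ) ∣ (A : Matrix (Idx g) (Idx g) ℤ) i j := by
  have := mem_Gamma_iff.mp hA i j
  rwa [Matrix.one_apply_ne hij, sub_zero] at this

lemma Gamma_one_sub_dvd {g d : ℕ} {A : ↥(SpZ g)} (hA : A ∈ Gamma g d) (i j : Idx g) :
    (d : ℤ) ∣ ((1 : Matrix (Idx g) (Idx g) ℤ) - (A : Matrix (Idx g) (Idx g) ℤ)) i j := by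
  have h := mem_Gamma_iff.mp hA i j
  have he : ((1 : Matrix (Idx g) (Idx g) ℤ) - (A : Matrix (Idx g) (Idx g) ℤ)) i j
      = -((A : Matrix (Idx g) (Idx g) ℤ) i j - (1 : Matrix (Idx g) (Idx g) ℤ) i j) := by
    rw [Matrix.sub_apply]; ring
  rw [he]
  exact dvd_neg.mpr h

lemma two_d_dvd_d_mul_d {d : ℕ} (hd : Even d) : (2 * d : ℤ) ∣ (d : ℤ) * (d : ℤ) := by
  obtain ⟨e, he⟩ := hd
  refine ⟨(e : ℤ), ?_⟩
  push_cast [he]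
  ring

/-- The subgroup `Γ_g[d, 2d]` (for even `d`) of `Γ_g[d]`: matrices `A = I + dA'` such that
the diagonal entries of the upper-right and lower-left `g×g` blocks of `A'` are even,
i.e. the `(inl i, inr i)` and `(inr i, inl i)` entries of `A` are divisible by `2d`. -/
def GammaMod (g : ℕ) (d : ℕ) (hd : Even d) : Subgroup ↥(SpZ g) where
  carrier := {A | A ∈ Gamma g d ∧ ∀ i : Fin g,
    (2 * d : ℤ) ∣ (A : Matrix (Idx g) (Idx g) ℤ) (Sum.inl i) (Sum.inr i) ∧
    (2 * d : ℤ) ∣ (A : Matrix (Idx g) (Idx g) ℤ) (Sum.inr i) (Sum.inl i)}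
  one_mem' := by
    refine ⟨one_mem _, fun i => ?_⟩
    constructor <;> simp [Matrix.one_apply]
  mul_mem' := by
    rintro a b ⟨ha1, ha2⟩ ⟨hb1, hb2⟩
    refine ⟨mul_mem ha1 hb1, fun i => ?_⟩
    constructor
    · rw [Submonoid.coe_mul, Matrix.mul_apply]
      refine Finset.dvd_sum fun k _ => ?_
      rcases k with k | k
      · by_cases hk : k = i
        · subst hk
          exact Dvd.dvd.mul_left (hb2 k).1 _
        · refine dvd_trans (two_d_dvd_d_mul_d hd) (mul_dvd_mul ?_ ?_)
          · exact Gamma_entry_dvd ha1 (by simp only [ne_eq, Sum.inl.injEq, Sum.inr.injEq]; first | exact fun h => hk h | exact fun h => hk h.symm)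
          · exact Gamma_entry_dvd hb1 (by simp)
      · by_cases hk : k = i
        · subst hk
          exact Dvd.dvd.mul_right (ha2 k).1 _
        · refine dvd_trans (two_d_dvd_d_mul_d hd) (mul_dvd_mul ?_ ?_)
          · exact Gamma_entry_dvd ha1 (by simp)
          · exact Gamma_entry_dvd hb1 (by simp only [ne_eq, Sum.inl.injEq, Sum.inr.injEq]; first | exact fun h => hk h | exact fun h => hk h.symm)
    · rw [Submonoid.coe_mul, Matrix.mul_apply]
      refine Finset.dvd_sum fun k _ => ?_
      rcases k with k | k
      · by_cases hk : k = i
        · subst hk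
          exact Dvd.dvd.mul_right (ha2 k).2 _
        · refine dvd_trans (two_d_dvd_d_mul_d hd) (mul_dvd_mul ?_ ?_)
          · exact Gamma_entry_dvd ha1 (by simp)
          · exact Gamma_entry_dvd hb1 (by simp only [ne_eq, Sum.inl.injEq, Sum.inr.injEq]; first | exact fun h => hk h | exact fun h => hk h.symm)
      · by_cases hk : k = i
        · subst hk
          exact Dvd.dvd.mul_left (hb2 k).2 _
        · refine dvd_trans (two_d_dvd_d_mul_d hd) (mul_dvd_mul ?_ ?_)
          · exact Gamma_entry_dvd ha1 (by simp only [ne_eq, Sum.inl.injEq, Sum.inr.injEq]; first | exact fun h => hk h | exact fun h => hk h.symm)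
          · exact Gamma_entry_dvd hb1 (by simp)
  inv_mem' := by
    rintro a ⟨ha1, ha2⟩
    refine ⟨inv_mem ha1, fun i => ?_⟩
    have hAA : ((a : ↥(SpZ g)) : Matrix (Idx g) (Idx g) ℤ) *
        ((a⁻¹ : ↥(SpZ g)) : Matrix (Idx g) (Idx g) ℤ) = 1 := by
      rw [← Submonoid.coe_mul, mul_inv_cancel, Submonoid.coe_one]
    have hAA' : ((a⁻¹ : ↥(SpZ g)) : Matrix (Idx g) (Idx g) ℤ) *
        ((a : ↥(SpZ g)) : Matrix (Idx g) (Idx g) ℤ) = 1 := by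
      rw [← Submonoid.coe_mul, inv_mul_cancel, Submonoid.coe_one]
    set X : Matrix (Idx g) (Idx g) ℤ := ((a⁻¹ : ↥(SpZ g)) : Matrix (Idx g) (Idx g) ℤ) with hX
    set A : Matrix (Idx g) (Idx g) ℤ := ((a : ↥(SpZ g)) : Matrix (Idx g) (Idx g) ℤ) with hA
    have key : X = (2 : ℤ) • (1 : Matrix (Idx g) (Idx g) ℤ) - A + (1 - A) * X * (1 - A) := by
      have e1 : ((1 : Matrix (Idx g) (Idx g) ℤ) - A) * X = X - 1 := by
        rw [sub_mul, one_mul, hAA]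
      have e2 : (X - 1) * ((1 : Matrix (Idx g) (Idx g) ℤ) - A) = X - 1 - (1 - A) := by
        rw [sub_mul, one_mul, mul_sub, mul_one, hAA']
      rw [e1, e2]
      have : (2 : ℤ) • (1 : Matrix (Idx g) (Idx g) ℤ) = 1 + 1 := by
        rw [two_smul]
      rw [this]
      abel
    have hprod : ∀ i' j' : Idx g, (2 * d : ℤ) ∣ ((1 - A) * X * (1 - A)) i' j' := by
      intro i' j'
      rw [Matrix.mul_apply]
      refine Finset.dvd_sum fun k _ => ?_
      refine dvd_trans (two_d_dvd_d_mul_d hd) (mul_dvd_mul ?_ ?_)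
      · rw [Matrix.mul_apply]
        refine Finset.dvd_sum fun l _ => ?_
        exact Dvd.dvd.mul_right (Gamma_one_sub_dvd ha1 i' l) _
      · exact Gamma_one_sub_dvd ha1 k j'
    constructor
    · rw [key]
      simp only [Matrix.add_apply, Matrix.sub_apply, Matrix.smul_apply,
        Matrix.one_apply_ne (show (Sum.inl i : Idx g) ≠ Sum.inr i by simp), smul_zero]
      refine dvd_add (dvd_sub (Dvd.intro 0 rfl) ?_) (hprod _ _)
      exact (ha2 i).1
    · rw [key]
      simp only [Matrix.add_apply, Matrix.sub_apply, Matrix.smul_apply,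
        Matrix.one_apply_ne (show (Sum.inr i : Idx g) ≠ Sum.inl i by simp), smul_zero]
      refine dvd_add (dvd_sub (Dvd.intro 0 rfl) ?_) (hprod _ _)
      exact (ha2 i).2

local notation "SL2" => Matrix.SpecialLinearGroup (Fin 2) ℤ

lemma SL2_det (M : SL2) : M 0 0 * M 1 1 - M 0 1 * M 1 0 = 1 := by
  rw [← Matrix.det_fin_two, M.det_coe]

lemma add_fin_two (a b c d a' b' c' d' : ℤ) :
    !![a, b; c, d] + !![a', b'; c', d'] = !![a + a', b + b'; c + c', d + d'] := by
  ext i j; fin_cases i <;> fin_cases j <;> rfl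

lemma eq_fin_two {a b c d a' b' c' d' : ℤ} :
    !![a, b; c, d] = !![a', b'; c', d'] ↔ (a = a' ∧ b = b') ∧ c = c' ∧ d = d' := by
  constructor
  · intro h
    exact ⟨⟨congr_fun₂ h 0 0, congr_fun₂ h 0 1⟩, congr_fun₂ h 1 0, congr_fun₂ h 1 1⟩
  · rintro ⟨⟨rfl, rfl⟩, rfl, rfl⟩; rfl

lemma transpose_fin_two (a b c d : ℤ) : !![a, b; c, d]ᵀ = !![a, c; b, d] := by
  ext i j; fin_cases i <;> fin_cases j <;> rfl

lemma J_fin_two : J (Fin 2) ℤ =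
    fromBlocks !![0, 0; 0, 0] !![-1, 0; 0, -1] !![1, 0; 0, 1] !![0, 0; 0, 0] := by
  ext i j
  rcases i with i | i <;> rcases j with j | j <;> fin_cases i <;> fin_cases j <;> rfl

lemma one_fin_two_blocks : (1 : Matrix (Idx 2) (Idx 2) ℤ) =
    fromBlocks !![1, 0; 0, 1] !![0, 0; 0, 0] !![0, 0; 0, 0] !![1, 0; 0, 1] := by
  ext i j
  rcases i with i | i <;> rcases j with j | j <;> fin_cases i <;> fin_cases j <;> rfl

lemma SL2_mul_apply (M M' : SL2) (i j : Fin 2) :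
    (M * M') i j = M i 0 * M' 0 j + M i 1 * M' 1 j := by
  simp [Matrix.mul_apply, Fin.sum_univ_two]

/-- The upper unipotent matrix with off-diagonal entry `t`. -/
def upperUni (t : ℤ) : SL2 := ⟨!![1, t; 0, 1], by simp⟩

/-- The lower unipotent matrix with off-diagonal entry `t`. -/
def lowerUni (t : ℤ) : SL2 := ⟨!![1, 0; t, 1], by simp⟩

/-- The embedding of `SL₂(ℤ)` in `Sp(4; ℤ)` acting on the first hyperbolic plane. -/
def longOne : SL2 →* SpZ 2 where
  toFun M := ⟨fromBlocks !![M 0 0, 0; 0, 1] !![M 0 1, 0; 0, 0] !![M 1 0, 0; 0, 0]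
    !![M 1 1, 0; 0, 1], by
      have h := SL2_det M
      simp only [SymplecticGroup.mem_iff, J_fin_two, fromBlocks_transpose, transpose_fin_two,
        fromBlocks_multiply, mul_fin_two, add_fin_two, fromBlocks_inj, eq_fin_two]
      grind⟩
  map_one' := by
    apply Subtype.ext
    simp [one_fin_two_blocks]
  map_mul' M M' := by
    apply Subtype.ext
    simp only [Submonoid.coe_mul, SL2_mul_apply,
      fromBlocks_multiply, mul_fin_two, add_fin_two, fromBlocks_inj, eq_fin_two]
    grind

/-- The embedding of `SL₂(ℤ)` in `Sp(4; ℤ)` acting on the second hyperbolic plane. -/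
def longTwo : SL2 →* SpZ 2 where
  toFun M := ⟨fromBlocks !![1, 0; 0, M 0 0] !![0, 0; 0, M 0 1] !![0, 0; 0, M 1 0]
    !![1, 0; 0, M 1 1], by
      have h := SL2_det M
      simp only [SymplecticGroup.mem_iff, J_fin_two, fromBlocks_transpose, transpose_fin_two,
        fromBlocks_multiply, mul_fin_two, add_fin_two, fromBlocks_inj, eq_fin_two]
      grind⟩
  map_one' := by
    apply Subtype.ext
    simp [one_fin_two_blocks]
  map_mul' M M' := by
    apply Subtype.ext
    simp only [Submonoid.coe_mul, SL2_mul_apply,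
      fromBlocks_multiply, mul_fin_two, add_fin_two, fromBlocks_inj, eq_fin_two]
    grind

/-- The embedding of `SL₂(ℤ)` in `Sp(4; ℤ)` as block diagonal matrices `diag(M, ᵗM⁻¹)`. -/
def levi : SL2 →* SpZ 2 where
  toFun M := ⟨fromBlocks !![M 0 0, M 0 1; M 1 0, M 1 1] !![0, 0; 0, 0] !![0, 0; 0, 0]
    !![M 1 1, -M 1 0; -M 0 1, M 0 0], by
      have h := SL2_det M
      simp only [SymplecticGroup.mem_iff, J_fin_two, fromBlocks_transpose, transpose_fin_two,
        fromBlocks_multiply, mul_fin_two, add_fin_two, fromBlocks_inj, eq_fin_two]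
      grind⟩
  map_one' := by
    apply Subtype.ext
    simp [one_fin_two_blocks]
  map_mul' M M' := by
    apply Subtype.ext
    simp only [Submonoid.coe_mul, SL2_mul_apply,
      fromBlocks_multiply, mul_fin_two, add_fin_two, fromBlocks_inj, eq_fin_two]
    grind

/-- The symplectic matrix whose upper right block is the symmetric matrix
with zero diagonal and off-diagonal entries `t`. -/
def siegelUpper (t : ℤ) : SpZ 2 :=
  ⟨fromBlocks !![1, 0; 0, 1] !![0, t; t, 0] !![0, 0; 0, 0] !![1, 0; 0, 1], by
      simp only [SymplecticGroup.mem_iff, J_fin_two, fromBlocks_transpose, transpose_fin_two,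
        fromBlocks_multiply, mul_fin_two, add_fin_two, fromBlocks_inj, eq_fin_two]
      grind⟩

/-- The symplectic matrix whose lower left block is the symmetric matrix
with zero diagonal and off-diagonal entries `t`. -/
def siegelLower (t : ℤ) : SpZ 2 :=
  ⟨fromBlocks !![1, 0; 0, 1] !![0, 0; 0, 0] !![0, t; t, 0] !![1, 0; 0, 1], by
      simp only [SymplecticGroup.mem_iff, J_fin_two, fromBlocks_transpose, transpose_fin_two,
        fromBlocks_multiply, mul_fin_two, add_fin_two, fromBlocks_inj, eq_fin_two]
      grind⟩

lemma long_levi_relation (X L L' : SL2) (ha : L 0 0 = X 0 0)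
    (h00 : L' 0 0 = X 0 0) (h01 : L' 0 1 = X 0 1 ^ 2 * L 0 1) (h10 : L' 1 0 = X 1 0 ^ 2 * L 1 0)
    (h11 : L' 1 1 = X 1 1 - X 0 1 * X 1 0 * L 1 1 + X 1 1 * X 0 1 * L 0 1 * X 1 0 * L 1 0) :
    longTwo (lowerUni (-(X 0 0 * L 1 0))) * siegelLower (X 1 0 * L 1 0) * levi X * longTwo L *
      levi (upperUni (-X 0 1)) * levi (lowerUni (-X 1 0)) *
      siegelUpper (-(X 1 1 * X 0 1 * L 0 1)) * longTwo (upperUni (-(X 0 0 * X 1 1 ^ 2 * L 0 1)))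
      = longOne L' := by
  have h := SL2_det X
  have h' := SL2_det L
  apply Subtype.ext
  simp only [Submonoid.coe_mul, longOne, longTwo, levi, siegelUpper, siegelLower, upperUni,
    lowerUni, MonoidHom.coe_mk, OneHom.coe_mk]
  simp [fromBlocks_multiply, fromBlocks_inj, h00, h01, h10, h11, ha]
  rw [ha] at h'
  generalize X 0 0 = a at *
  generalize X 0 1 = b at *
  generalize X 1 0 = c at *
  generalize X 1 1 = e at *
  generalize L 0 1 = b1 at *
  generalize L 1 0 = c1 at *
  generalize L 1 1 = e1 at *
  grind

lemma upperUni_apply (t : ℤ) : upperUni t 0 0 = 1 ∧ upperUni t 0 1 = t ∧ upperUni t 1 0 = 0 ∧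
    upperUni t 1 1 = 1 := ⟨rfl, rfl, rfl, rfl⟩

lemma lowerUni_apply (t : ℤ) : lowerUni t 0 0 = 1 ∧ lowerUni t 0 1 = 0 ∧ lowerUni t 1 0 = t ∧
    lowerUni t 1 1 = 1 := ⟨rfl, rfl, rfl, rfl⟩

lemma SL2_ext {M M' : SL2} (h00 : M 0 0 = M' 0 0) (h01 : M 0 1 = M' 0 1) (h10 : M 1 0 = M' 1 0)
    (h11 : M 1 1 = M' 1 1) : M = M' := by
  ext i j
  fin_cases i <;> fin_cases j <;> assumption

/-- `M ∈ SL₂(ℤ)` is congruent to the identity mod `Q`. -/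
def IsCongrOne (Q : ℤ) (M : SL2) : Prop :=
  Q ∣ M 0 0 - 1 ∧ Q ∣ M 0 1 ∧ Q ∣ M 1 0 ∧ Q ∣ M 1 1 - 1

lemma isCoprime_level {Q a : ℤ} (ha : Q ∣ a - 1) : IsCoprime a Q := by
  obtain ⟨k, hk⟩ := ha
  exact ⟨1, -k, by linarith⟩

lemma exists_isCongrOne {Q a b : ℤ} (ha : Q ∣ a - 1) (hb : Q ∣ b) (hab : IsCoprime a b) :
    ∃ M : SL2, IsCongrOne Q M ∧ M 0 0 = a ∧ M 0 1 = b := by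
  obtain ⟨x, y, hxy⟩ := hab.mul_right (isCoprime_level ha)
  refine ⟨⟨!![a, b; -(y * Q), x], by rw [det_fin_two_of]; linarith⟩, ⟨ha, hb, ?_, ?_⟩, rfl, rfl⟩
  · exact ⟨-y, by simp [mul_comm]⟩
  · have : x - 1 = -(x * (a - 1)) - y * b * Q := by linarith
    change Q ∣ x - 1
    rw [this]
    exact dvd_sub (dvd_neg.mpr (ha.mul_left _)) (dvd_mul_left _ _)

section Symbol

variable {G : Type*} [Group G]

/-- `Λ` kills the elementary matrices of level `Q`. -/
def KillsElementary (Q : ℤ) (Λ : SL2 →* G) : Prop :=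
  ∀ t, Λ (upperUni (Q * t)) = 1 ∧ Λ (lowerUni (Q * t)) = 1

lemma KillsElementary.eq_of_row {Q : ℤ} {Λ : SL2 →* G} (hΛ : KillsElementary Q Λ) {M M' : SL2}
    (hM : IsCongrOne Q M) (hM' : IsCongrOne Q M') (h00 : M' 0 0 = M 0 0)
    (h01 : Q * M 0 0 ∣ M' 0 1 - M 0 1) : Λ M' = Λ M := by
  obtain ⟨k, hk⟩ := h01
  obtain ⟨u, hu⟩ := hM.2.2.1
  obtain ⟨u', hu'⟩ := hM'.2.2.1
  have hd := SL2_det M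
  have hd' := SL2_det M'
  have : M' = lowerUni (Q * (u' * (M 1 1 + Q * k * M 1 0) - M' 1 1 * u)) * M *
      upperUni (Q * k) := by
    obtain ⟨p1, p2, p3, p4⟩ := upperUni_apply (Q * k)
    obtain ⟨q1, q2, q3, q4⟩ := lowerUni_apply (Q * (u' * (M 1 1 + Q * k * M 1 0) - M' 1 1 * u))
    apply SL2_ext <;> simp only [SL2_mul_apply, p1, p2, p3, p4, q1, q2, q3, q4] <;>
      generalize M 0 0 = a at * <;> generalize M 0 1 = b at * <;> generalize M 1 0 = c at * <;>
      generalize M 1 1 = e at * <;> generalize M' 0 0 = a' at * <;>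
      generalize M' 0 1 = b' at * <;> generalize M' 1 0 = c' at * <;>
      generalize M' 1 1 = e' at * <;> clear p1 p2 p3 p4 q1 q2 q3 q4 hM hM' <;> grind
  rw [this, map_mul, map_mul, (hΛ _).1, (hΛ _).2, one_mul, mul_one]

lemma KillsElementary.eq_one_of_row {Q : ℤ} {Λ : SL2 →* G} (hΛ : KillsElementary Q Λ) {M : SL2}
    (hM : IsCongrOne Q M) {ε : ℤ} (hε : ε * ε = 1) (h01 : M 0 1 = Q * ε) : Λ M = 1 := by
  obtain ⟨u, hu⟩ := hM.1
  obtain ⟨v, hv⟩ := hM.2.2.1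
  obtain ⟨w, hw⟩ := hM.2.2.2
  have hd := SL2_det M
  have : M = (lowerUni (ε * u))⁻¹ * (lowerUni (Q * (v - ε * u * w)) *
      upperUni (Q * ε)) * lowerUni (ε * u) := by
    rw [mul_assoc, eq_inv_mul_iff_mul_eq]
    obtain ⟨p1, p2, p3, p4⟩ := upperUni_apply (Q * ε)
    obtain ⟨q1, q2, q3, q4⟩ := lowerUni_apply (Q * (v - ε * u * w))
    obtain ⟨r1, r2, r3, r4⟩ := lowerUni_apply (ε * u)
    apply SL2_ext <;> simp only [SL2_mul_apply, p1, p2, p3, p4, q1, q2, q3, q4, r1, r2, r3, r4] <;>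
      generalize M 0 0 = a at * <;> generalize M 0 1 = b at * <;> generalize M 1 0 = c at * <;>
      generalize M 1 1 = e at * <;> clear p1 p2 p3 p4 q1 q2 q3 q4 r1 r2 r3 r4 hM <;> grind
  rw [this, map_mul, map_mul, map_mul, (hΛ _).1, (hΛ _).2, mul_one, mul_one, ← map_mul,
    inv_mul_cancel, map_one]

/-- Two long root homomorphisms `Λ₁`, `Λ₂` and a short root homomorphism `S` which kill the
elementary matrices of level `Q` and satisfy the multiplicativity relation of
Mennicke symbols. -/
structure SymbolData (Q : ℤ) (Λ₁ Λ₂ S : SL2 →* G) : Prop where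
  kills₁ : KillsElementary Q Λ₁
  kills₂ : KillsElementary Q Λ₂
  killsS : KillsElementary Q S
  relation : ∀ X L L' : SL2, IsCongrOne Q X → IsCongrOne Q L → IsCongrOne Q L' →
    L 0 0 = X 0 0 → L' 0 0 = X 0 0 → L' 0 1 = X 0 1 ^ 2 * L 0 1 → Λ₁ L' = S X * Λ₂ L

lemma SymbolData.pow_eq_one_of_prime {Q : ℤ} {Λ₁ Λ₂ S : SL2 →* G} (h : SymbolData Q Λ₁ Λ₂ S)
    {M : SL2} (hM : IsCongrOne Q M) {p : ℕ} (hp : p.Prime) (hpM : M 0 0 = -(p : ℤ)) {j : ℕ}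
    (hj : p = 2 * (2 * j + 1) + 1) : Λ₂ M ^ (2 * j + 1) = 1 := by
  obtain ⟨β, hβ⟩ := hM.2.1
  set a := M 0 0 with ha
  have hdet := SL2_det M
  have hab : IsCoprime a (Q * β) := ⟨M 1 1, -M 1 0, by rw [← hβ]; linarith⟩
  have haβ : IsCoprime a β := hab.of_mul_right_right
  have haQ : IsCoprime a Q := hab.of_mul_right_left
  have lift : ∀ c, IsCoprime a c → ∃ L : SL2, IsCongrOne Q L ∧ L 0 0 = a ∧ L 0 1 = Q * c :=
    fun c hc => exists_isCongrOne hM.1 (dvd_mul_right _ _) (haQ.mul_right hc)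
  choose L hL hLa hLb using lift
  have one_of_sq : ∀ c (hc : IsCoprime a c) (ε : ℤ), ε * ε = 1 → a ∣ c - ε →
      Λ₂ (L c hc) = 1 := by
    intro c hc ε hε hd
    have hε' : IsCoprime a ε := ⟨0, ε, by linarith⟩
    rw [← h.kills₂.eq_one_of_row (hL ε hε') hε (hLb ε hε')]
    refine h.kills₂.eq_of_row (hL _ _) (hL _ _) (by rw [hLa, hLa]) ?_
    rw [hLa, hLb, hLb, ← mul_sub]
    exact mul_dvd_mul_left _ hd
  have hS1 : S (L 1 isCoprime_one_right) = 1 :=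
    h.killsS.eq_one_of_row (hL _ _) (one_mul 1) (hLb _ _)
  have step : ∀ c (hc : IsCoprime a c) (hc' : IsCoprime a (β ^ 2 * c)),
      Λ₂ (L (β ^ 2 * c) hc') = S (L β haβ) * Λ₂ (L c hc) := by
    intro c hc hc'
    have hc'' : IsCoprime a (Q ^ 2 * (β ^ 2 * c)) := haQ.pow_right.mul_right hc'
    rw [← h.relation (L β haβ) (L c hc) (L _ hc'') (hL _ _) (hL _ _) (hL _ _)
        (by rw [hLa, hLa]) (by rw [hLa, hLa]) (by rw [hLb, hLb, hLb]; ring),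
      h.relation (L 1 isCoprime_one_right) (L _ hc') (L _ hc'') (hL _ _) (hL _ _) (hL _ _)
        (by rw [hLa, hLa]) (by rw [hLa, hLa]) (by rw [hLb, hLb, hLb]; ring), hS1, one_mul]
  have step_pow : ∀ (i : ℕ) c (hc : IsCoprime a c) (hc' : IsCoprime a (β ^ (2 * i) * c)),
      Λ₂ (L (β ^ (2 * i) * c) hc') = S (L β haβ) ^ i * Λ₂ (L c hc) := by
    intro i c hc
    induction i with
    | zero =>
      intro hc'
      simp
    | succ i ih =>
      have hi : IsCoprime a (β ^ (2 * i) * c) := haβ.pow_right.mul_right hc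
      have e : β ^ (2 * (i + 1)) * c = β ^ 2 * (β ^ (2 * i) * c) := by ring
      rw [e]
      intro hc'
      rw [step _ hi, ih hi, pow_succ', mul_assoc]
  have hMβ : Λ₂ M = Λ₂ (L β haβ) :=
    h.kills₂.eq_of_row (hL _ _) hM (by rw [hLa]) (by rw [hLb, hβ]; simp)
  have := Fact.mk hp
  have hfermat : ((β : ZMod p)) ^ (p - 1) = 1 := by
    apply ZMod.pow_card_sub_one_eq_one
    rw [Ne, ZMod.intCast_zmod_eq_zero_iff_dvd]
    intro hdvd
    have hu : IsUnit (p : ℤ) := by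
      refine isUnit_of_dvd_unit ?_ (haβ.isUnit_of_dvd' (dvd_refl _) ?_)
      · rw [hpM]; exact (dvd_neg.mpr dvd_rfl)
      · rw [hpM]; exact (neg_dvd.mpr hdvd)
    exact (Nat.prime_iff_prime_int.mp hp).not_isUnit hu
  have hp1 : p - 1 = 2 * (2 * j + 1) := by omega
  have hsq : a ∣ β ^ (2 * (2 * j + 1)) - 1 := by
    rw [hpM, neg_dvd, ← ZMod.intCast_zmod_eq_zero_iff_dvd]
    push_cast
    rw [← hp1, hfermat, sub_self]
  have hS : S (L β haβ) ^ (2 * j + 1) = 1 := by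
    have h1 := step_pow (2 * j + 1) 1 isCoprime_one_right
      (haβ.pow_right.mul_right isCoprime_one_right)
    rw [one_of_sq _ _ 1 (one_mul 1) (by rwa [mul_one]),
      one_of_sq 1 _ 1 (one_mul 1) (by simp), mul_one] at h1
    exact h1.symm
  have hMS : S (L β haβ) ^ j * Λ₂ M = 1 := by
    have h1 := step_pow j β haβ (haβ.pow_right.mul_right haβ)
    rw [hMβ, ← h1]
    have hpp : Prime a := by
      rw [hpM]; exact (Nat.prime_iff_prime_int.mp hp).neg
    have hfac : a ∣ (β ^ (2 * j) * β - 1) * (β ^ (2 * j) * β - (-1)) := by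
      convert hsq using 1; ring
    rcases hpp.dvd_or_dvd hfac with hd | hd
    · exact one_of_sq _ _ 1 (one_mul 1) hd
    · exact one_of_sq _ _ (-1) (by norm_num) hd
  rw [eq_inv_of_mul_eq_one_right hMS, inv_pow, ← pow_mul, mul_comm, pow_mul, hS, one_pow, inv_one]

end Symbol

lemma exists_prime_neg_progression {a b : ℤ} {l : ℕ} (hl : l.Prime) (hb : b ≠ 0)
    (hab : IsCoprime a b) (h : (l : ℤ) ∣ a - 1 ∨ ¬ (l : ℤ) ∣ b) :
    ∃ (p : ℕ) (t : ℤ), p.Prime ∧ a + t * b = -(p : ℤ) ∧ (l : ℤ) ∣ p + 1 := by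
  obtain ⟨t₀, ht₀⟩ : ∃ t₀ : ℤ, (l : ℤ) ∣ a + t₀ * b - 1 := by
    rcases h with h | h
    · exact ⟨0, by simpa using h⟩
    · obtain ⟨u, v, huv⟩ := ((Nat.prime_iff_prime_int.mp hl).coprime_iff_not_dvd.mpr h)
      exact ⟨v * (1 - a), u * (a - 1), by linear_combination (1 - a) * huv⟩
  have hcop : IsCoprime (a + t₀ * b) (b * l) := by
    refine IsCoprime.mul_right ?_ (isCoprime_level ht₀)
    simpa [add_comm, mul_comm] using hab.add_mul_right_left t₀
  have hne : (b * l).natAbs ≠ 0 := by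
    simp [hb, hl.ne_zero]
  have hcop' : IsCoprime (-(a + t₀ * b)) ((b * l).natAbs : ℤ) := by
    rw [Int.natCast_natAbs]
    exact hcop.neg_left.abs_right
  obtain ⟨p, -, hp, hmod⟩ := Nat.forall_exists_prime_gt_and_zmodEq 0 hne hcop'
  have hdvd : b * l ∣ -(a + t₀ * b) - p := Int.natAbs_dvd.mp hmod.dvd
  obtain ⟨k, hk⟩ := hdvd
  refine ⟨p, t₀ + l * k, hp, by linear_combination -hk, ?_⟩
  have : (p : ℤ) + 1 = -(a + t₀ * b - 1) - l * (b * k) := by linear_combination -hk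
  rw [this]
  exact dvd_sub (dvd_neg.mpr ht₀) (dvd_mul_right _ _)

lemma SymbolData.long_eq_one {G : Type*} [Group G] {Q : ℤ} {Λ₁ Λ₂ S : SL2 →* G}
    (h : SymbolData Q Λ₁ Λ₂ S) (hQ0 : Q ≠ 0) (hQ4 : 4 ∣ Q)
    {M : SL2} (hM : IsCongrOne Q M) : Λ₂ M = 1 := by
  by_contra hne
  obtain ⟨l, hl, hln⟩ := Nat.exists_prime_and_dvd (mt orderOf_eq_one_iff.mp hne)
  have hdet := SL2_det M
  have hlp := Nat.prime_iff_prime_int.mp hl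
  obtain ⟨s, hb0, hlb⟩ : ∃ s : ℤ, M 0 1 + Q * s * M 0 0 ≠ 0 ∧
      ((l : ℤ) ∣ M 0 0 - 1 ∨ ¬ (l : ℤ) ∣ M 0 1 + Q * s * M 0 0) := by
    have ha0 : M 0 0 ≠ 0 := by
      intro h0
      have := hQ4.trans hM.1
      rw [h0] at this
      omega
    by_cases hb : M 0 1 = 0
    · refine ⟨1, by simp [hb, hQ0, ha0], ?_⟩
      by_cases hlQ : (l : ℤ) ∣ Q
      · exact Or.inl (hlQ.trans hM.1)
      · refine Or.inr fun hd => ?_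
        rw [hb, zero_add, mul_one] at hd
        rcases hlp.dvd_or_dvd hd with hd | hd
        · exact hlQ hd
        · apply hlp.not_dvd_one
          rw [← hdet, hb, zero_mul, sub_zero]
          exact hd.mul_right _
    · by_cases hlQ : (l : ℤ) ∣ M 0 0 - 1
      · exact ⟨0, by simpa using hb, Or.inl hlQ⟩
      by_cases hlb : (l : ℤ) ∣ M 0 1
      · have : ¬ (l : ℤ) ∣ M 0 1 + Q * 1 * M 0 0 := by
          intro hd
          rw [dvd_add_right hlb, mul_one] at hd
          rcases hlp.dvd_or_dvd hd with hd | hd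
          · exact hlQ (hd.trans hM.1)
          · apply hlp.not_dvd_one
            rw [← hdet]
            exact dvd_sub (hd.mul_right _) (hlb.mul_right _)
        exact ⟨1, fun h0 => this (h0 ▸ dvd_zero _), Or.inr this⟩
      · exact ⟨0, by simpa using hb, Or.inr (by simpa using hlb)⟩
  have hcop : IsCoprime (M 0 0) (M 0 1 + Q * s * M 0 0) :=
    ⟨M 1 1 + M 1 0 * Q * s, -M 1 0, by linear_combination hdet⟩
  obtain ⟨p, t, hp, hpt, hlp1⟩ := exists_prime_neg_progression hl hb0 hcop hlb
  set M' : SL2 := (lowerUni t)⁻¹ * (M * upperUni (Q * s)) * lowerUni t with hM'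
  have hinv : (lowerUni t)⁻¹ = lowerUni (-t) := by
    rw [inv_eq_iff_mul_eq_one]
    apply SL2_ext <;> simp [SL2_mul_apply, lowerUni_apply]
  have hΛ : Λ₂ M' = (Λ₂ (lowerUni t))⁻¹ * Λ₂ M * Λ₂ (lowerUni t) := by
    rw [hM', map_mul, map_mul, map_mul, (h.kills₂ _).1, mul_one, map_inv]
  have hM'00 : M' 0 0 = -(p : ℤ) := by
    rw [← hpt, hM', hinv]
    simp [SL2_mul_apply, lowerUni_apply, upperUni_apply]
    ring
  have hM'Q : IsCongrOne Q M' := by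
    obtain ⟨⟨k1, h1⟩, ⟨k2, h2⟩, ⟨k3, h3⟩, ⟨k4, h4⟩⟩ := hM
    rw [hM', hinv]
    refine ⟨⟨k1 + t * (k2 + s * M 0 0), ?_⟩, ⟨k2 + s * M 0 0, ?_⟩,
      ⟨k3 - t * k1 + t * (k4 + M 1 0 * s - t * (k2 + s * M 0 0)), ?_⟩,
      ⟨k4 + M 1 0 * s - t * (k2 + s * M 0 0), ?_⟩⟩ <;>
    simp [SL2_mul_apply, lowerUni_apply, upperUni_apply] <;> grind
  have hp4 : (4 : ℤ) ∣ -(p : ℤ) - 1 := hM'00 ▸ hQ4.trans hM'Q.1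
  obtain ⟨j, hj⟩ : ∃ j, p = 2 * (2 * j + 1) + 1 := ⟨p / 4, by omega⟩
  have hpow := h.pow_eq_one_of_prime hM'Q hp hM'00 hj
  have hpowM : Λ₂ M ^ (2 * j + 1) = 1 := by
    have := conj_pow (a := (Λ₂ (lowerUni t))⁻¹) (b := Λ₂ M) (i := 2 * j + 1)
    rw [inv_inv, ← hΛ, hpow] at this
    exact (conj_eq_one_iff).mp (by rw [inv_inv]; exact this.symm)
  have hlk : (l : ℤ) ∣ (2 * j + 1 : ℕ) :=
    Int.natCast_dvd_natCast.mpr (hln.trans (orderOf_dvd_of_pow_eq_one hpowM))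
  have hl2 : (l : ℤ) ∣ 2 := by
    have e : (2 : ℤ) = (p + 1) - 2 * (2 * j + 1 : ℕ) := by rw [hj]; push_cast; ring
    rw [e]
    exact dvd_sub hlp1 (hlk.mul_left _)
  have : l ∣ 2 := by exact_mod_cast hl2
  rw [(Nat.prime_dvd_prime_iff_eq hl Nat.prime_two).mp this] at hlk
  omega

lemma mem_Gamma_of_longOne {m : ℕ} {M : SL2} (hM : IsCongrOne m M) : longOne M ∈ Gamma 2 m := by
  obtain ⟨h1, h2, h3, h4⟩ := hM
  rw [mem_Gamma_iff]
  rintro (i | i) (j | j) <;> fin_cases i <;> fin_cases j <;> simp [longOne, *]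

lemma mem_Gamma_of_longTwo {m : ℕ} {M : SL2} (hM : IsCongrOne m M) : longTwo M ∈ Gamma 2 m := by
  obtain ⟨h1, h2, h3, h4⟩ := hM
  rw [mem_Gamma_iff]
  rintro (i | i) (j | j) <;> fin_cases i <;> fin_cases j <;> simp [longTwo, *]

lemma mem_Gamma_of_levi {m : ℕ} {M : SL2} (hM : IsCongrOne m M) : levi M ∈ Gamma 2 m := by
  obtain ⟨h1, h2, h3, h4⟩ := hM
  rw [mem_Gamma_iff]
  rintro (i | i) (j | j) <;> fin_cases i <;> fin_cases j <;> simp [levi, *]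

lemma mem_Gamma_of_siegelUpper {m : ℕ} {t : ℤ} (ht : (m : ℤ) ∣ t) : siegelUpper t ∈ Gamma 2 m := by
  rw [mem_Gamma_iff]
  rintro (i | i) (j | j) <;> fin_cases i <;> fin_cases j <;> simp [siegelUpper, *]

lemma mem_Gamma_of_siegelLower {m : ℕ} {t : ℤ} (ht : (m : ℤ) ∣ t) : siegelLower t ∈ Gamma 2 m := by
  rw [mem_Gamma_iff]
  rintro (i | i) (j | j) <;> fin_cases i <;> fin_cases j <;> simp [siegelLower, *]

lemma isCongrOne_upperUni {Q t : ℤ} (ht : Q ∣ t) : IsCongrOne Q (upperUni t) :=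
  ⟨by simp [upperUni_apply], ht, dvd_zero _, by simp [upperUni_apply]⟩

lemma isCongrOne_lowerUni {Q t : ℤ} (ht : Q ∣ t) : IsCongrOne Q (lowerUni t) :=
  ⟨by simp [lowerUni_apply], dvd_zero _, ht, by simp [lowerUni_apply]⟩

open scoped commutatorElement in
lemma mem_commutator_of_mul_eq {G : Type*} [Group G] {H : Subgroup G} {a b z : G} (ha : a ∈ H)
    (hb : b ∈ H) (h : a * b = z * (b * a)) : z ∈ ⁅H, H⁆ := by
  have : z = ⁅a, b⁆ := by
    rw [commutatorElement_def, eq_mul_inv_iff_mul_eq, eq_mul_inv_iff_mul_eq, mul_assoc, h]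
  rw [this]
  exact Subgroup.commutator_mem_commutator ha hb

lemma levi_upper_siegelUpper (x y : ℤ) : levi (upperUni x) * siegelUpper y =
    longOne (upperUni (2 * x * y)) * (siegelUpper y * levi (upperUni x)) := by
  apply Subtype.ext
  simp [longOne, levi, siegelUpper, upperUni, fromBlocks_multiply,
    fromBlocks_inj]
  ring

lemma levi_lower_siegelUpper (x y : ℤ) : levi (lowerUni x) * siegelUpper y =
    longTwo (upperUni (2 * x * y)) * (siegelUpper y * levi (lowerUni x)) := by
  apply Subtype.ext
  simp [longTwo, levi, siegelUpper, upperUni, lowerUni, fromBlocks_multiply,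
    fromBlocks_inj]
  ring

lemma levi_upper_siegelLower (x y : ℤ) : levi (upperUni x) * siegelLower y =
    longTwo (lowerUni (-(2 * x * y))) * (siegelLower y * levi (upperUni x)) := by
  apply Subtype.ext
  simp [longTwo, levi, siegelLower, upperUni, lowerUni, fromBlocks_multiply,
    fromBlocks_inj]
  ring

lemma levi_lower_siegelLower (x y : ℤ) : levi (lowerUni x) * siegelLower y =
    longOne (lowerUni (-(2 * x * y))) * (siegelLower y * levi (lowerUni x)) := by
  apply Subtype.ext
  simp [longOne, levi, siegelLower, lowerUni, fromBlocks_multiply,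
    fromBlocks_inj]
  ring

lemma levi_upper_longTwo_upper (x y : ℤ) : levi (upperUni x) * longTwo (upperUni y) =
    siegelUpper (x * y) * longOne (upperUni (x * x * y)) *
      (longTwo (upperUni y) * levi (upperUni x)) := by
  apply Subtype.ext
  simp [longOne, longTwo, levi, siegelUpper, upperUni, fromBlocks_multiply,
    fromBlocks_inj]
  and_intros <;> ring

lemma levi_upper_longOne_lower (x y : ℤ) : levi (upperUni x) * longOne (lowerUni y) =
    siegelLower (-(x * y)) * longTwo (lowerUni (x * x * y)) *
      (longOne (lowerUni y) * levi (upperUni x)) := by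
  apply Subtype.ext
  simp [longOne, longTwo, levi, siegelLower, upperUni, lowerUni, fromBlocks_multiply,
    fromBlocks_inj]
  and_intros <;> ring

lemma siegelUpper_longTwo_lower (x y : ℤ) : siegelUpper x * longTwo (lowerUni y) =
    levi (upperUni (x * y)) * longOne (upperUni (-(x * x * y))) *
      (longTwo (lowerUni y) * siegelUpper x) := by
  apply Subtype.ext
  simp [longOne, longTwo, levi, siegelUpper, upperUni, lowerUni, fromBlocks_multiply,
    fromBlocks_inj]
  and_intros <;> ring

lemma siegelUpper_longOne_lower (x y : ℤ) : siegelUpper x * longOne (lowerUni y) =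
    levi (lowerUni (x * y)) * longTwo (upperUni (-(x * x * y))) *
      (longOne (lowerUni y) * siegelUpper x) := by
  apply Subtype.ext
  simp [longOne, longTwo, levi, siegelUpper, upperUni, lowerUni, fromBlocks_multiply,
    fromBlocks_inj]
  and_intros <;> ring

section Elementary

variable {d : ℕ}

lemma longOne_upper_mem {t : ℤ} (ht : 2 * (d : ℤ) ^ 2 ∣ t) :
    longOne (upperUni t) ∈ ⁅Gamma 2 d, Gamma 2 d⁆ := by
  obtain ⟨k, rfl⟩ := ht
  have h := levi_upper_siegelUpper d (d * k)
  rw [show 2 * (d : ℤ) * (d * k) = 2 * (d : ℤ) ^ 2 * k by ring] at h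
  exact mem_commutator_of_mul_eq (mem_Gamma_of_levi (isCongrOne_upperUni dvd_rfl))
    (mem_Gamma_of_siegelUpper (dvd_mul_right _ _)) h

lemma longTwo_upper_mem {t : ℤ} (ht : 2 * (d : ℤ) ^ 2 ∣ t) :
    longTwo (upperUni t) ∈ ⁅Gamma 2 d, Gamma 2 d⁆ := by
  obtain ⟨k, rfl⟩ := ht
  have h := levi_lower_siegelUpper d (d * k)
  rw [show 2 * (d : ℤ) * (d * k) = 2 * (d : ℤ) ^ 2 * k by ring] at h
  exact mem_commutator_of_mul_eq (mem_Gamma_of_levi (isCongrOne_lowerUni dvd_rfl))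
    (mem_Gamma_of_siegelUpper (dvd_mul_right _ _)) h

lemma longTwo_lower_mem {t : ℤ} (ht : 2 * (d : ℤ) ^ 2 ∣ t) :
    longTwo (lowerUni t) ∈ ⁅Gamma 2 d, Gamma 2 d⁆ := by
  obtain ⟨k, rfl⟩ := ht
  have h := levi_upper_siegelLower d (d * -k)
  rw [show -(2 * (d : ℤ) * (d * -k)) = 2 * (d : ℤ) ^ 2 * k by ring] at h
  exact mem_commutator_of_mul_eq (mem_Gamma_of_levi (isCongrOne_upperUni dvd_rfl))
    (mem_Gamma_of_siegelLower (dvd_mul_right _ _)) h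

lemma longOne_lower_mem {t : ℤ} (ht : 2 * (d : ℤ) ^ 2 ∣ t) :
    longOne (lowerUni t) ∈ ⁅Gamma 2 d, Gamma 2 d⁆ := by
  obtain ⟨k, rfl⟩ := ht
  have h := levi_lower_siegelLower d (d * -k)
  rw [show -(2 * (d : ℤ) * (d * -k)) = 2 * (d : ℤ) ^ 2 * k by ring] at h
  exact mem_commutator_of_mul_eq (mem_Gamma_of_levi (isCongrOne_lowerUni dvd_rfl))
    (mem_Gamma_of_siegelLower (dvd_mul_right _ _)) h

lemma two_mul_sq_dvd_cube (hd : Even d) (k : ℤ) : 2 * (d : ℤ) ^ 2 ∣ d * d * (d * k) := by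
  obtain ⟨e, he⟩ := hd
  exact ⟨e * k, by rw [he]; push_cast; ring⟩

lemma siegelUpper_mem (hd : Even d) {t : ℤ} (ht : (d : ℤ) ^ 2 ∣ t) :
    siegelUpper t ∈ ⁅Gamma 2 d, Gamma 2 d⁆ := by
  obtain ⟨k, rfl⟩ := ht
  have h := levi_upper_longTwo_upper d (d * k)
  rw [show (d : ℤ) * (d * k) = (d : ℤ) ^ 2 * k by ring] at h
  exact (Subgroup.mul_mem_cancel_right _ (longOne_upper_mem (two_mul_sq_dvd_cube hd k))).mp <|
    mem_commutator_of_mul_eq (mem_Gamma_of_levi (isCongrOne_upperUni dvd_rfl))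
    (mem_Gamma_of_longTwo (isCongrOne_upperUni (dvd_mul_right _ _))) h

lemma siegelLower_mem (hd : Even d) {t : ℤ} (ht : (d : ℤ) ^ 2 ∣ t) :
    siegelLower t ∈ ⁅Gamma 2 d, Gamma 2 d⁆ := by
  obtain ⟨k, rfl⟩ := ht
  have h := levi_upper_longOne_lower d (d * -k)
  rw [show -((d : ℤ) * (d * -k)) = (d : ℤ) ^ 2 * k by ring] at h
  exact (Subgroup.mul_mem_cancel_right _ (longTwo_lower_mem (two_mul_sq_dvd_cube hd (-k)))).mp <|
    mem_commutator_of_mul_eq (mem_Gamma_of_levi (isCongrOne_upperUni dvd_rfl))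
    (mem_Gamma_of_longOne (isCongrOne_lowerUni (dvd_mul_right _ _))) h

lemma levi_upper_mem (hd : Even d) {t : ℤ} (ht : (d : ℤ) ^ 2 ∣ t) :
    levi (upperUni t) ∈ ⁅Gamma 2 d, Gamma 2 d⁆ := by
  obtain ⟨k, rfl⟩ := ht
  have h := siegelUpper_longTwo_lower d (d * k)
  rw [show (d : ℤ) * (d * k) = (d : ℤ) ^ 2 * k by ring] at h
  exact (Subgroup.mul_mem_cancel_right _
      (longOne_upper_mem (dvd_neg.mpr (two_mul_sq_dvd_cube hd k)))).mp <|
    mem_commutator_of_mul_eq (mem_Gamma_of_siegelUpper dvd_rfl)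
    (mem_Gamma_of_longTwo (isCongrOne_lowerUni (dvd_mul_right _ _))) h

lemma levi_lower_mem (hd : Even d) {t : ℤ} (ht : (d : ℤ) ^ 2 ∣ t) :
    levi (lowerUni t) ∈ ⁅Gamma 2 d, Gamma 2 d⁆ := by
  obtain ⟨k, rfl⟩ := ht
  have h := siegelUpper_longOne_lower d (d * k)
  rw [show (d : ℤ) * (d * k) = (d : ℤ) ^ 2 * k by ring] at h
  exact (Subgroup.mul_mem_cancel_right _
      (longTwo_upper_mem (dvd_neg.mpr (two_mul_sq_dvd_cube hd k)))).mp <|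
    mem_commutator_of_mul_eq (mem_Gamma_of_siegelUpper dvd_rfl)
    (mem_Gamma_of_longOne (isCongrOne_lowerUni (dvd_mul_right _ _))) h

end Elementary

instance Gamma_normal (g d : ℕ) : (Gamma g d).Normal where
  conj_mem a ha b := by
    change modred g d _ = 1 at ha
    change modred g d _ = 1
    rw [Submonoid.coe_mul, Submonoid.coe_mul, _root_.map_mul, _root_.map_mul, ha, mul_one,
      ← _root_.map_mul, ← Submonoid.coe_mul, mul_inv_cancel, Submonoid.coe_one, _root_.map_one]

lemma symbolData_commutator {d : ℕ} (hd : Even d) :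
    SymbolData (2 * (d : ℤ) ^ 2)
      ((QuotientGroup.mk' ⁅Gamma 2 d, Gamma 2 d⁆).comp longOne)
      ((QuotientGroup.mk' ⁅Gamma 2 d, Gamma 2 d⁆).comp longTwo)
      ((QuotientGroup.mk' ⁅Gamma 2 d, Gamma 2 d⁆).comp levi) := by
  have hq : ∀ {t}, 2 * (d : ℤ) ^ 2 ∣ t → (d : ℤ) ^ 2 ∣ t := (dvd_mul_left _ _).trans
  have kills₁ : KillsElementary (2 * (d : ℤ) ^ 2)
      ((QuotientGroup.mk' ⁅Gamma 2 d, Gamma 2 d⁆).comp longOne) := fun t =>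
    ⟨(QuotientGroup.eq_one_iff _).mpr (longOne_upper_mem (dvd_mul_right _ _)),
      (QuotientGroup.eq_one_iff _).mpr (longOne_lower_mem (dvd_mul_right _ _))⟩
  refine ⟨kills₁, fun t =>
    ⟨(QuotientGroup.eq_one_iff _).mpr (longTwo_upper_mem (dvd_mul_right _ _)),
      (QuotientGroup.eq_one_iff _).mpr (longTwo_lower_mem (dvd_mul_right _ _))⟩, fun t =>
    ⟨(QuotientGroup.eq_one_iff _).mpr (levi_upper_mem hd (hq (dvd_mul_right _ _))),
      (QuotientGroup.eq_one_iff _).mpr (levi_lower_mem hd (hq (dvd_mul_right _ _)))⟩, ?_⟩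
  intro X L L' hX hL hL' ha ha' hb
  have hdX := SL2_det X
  have hdL := SL2_det L
  let L₀ : SL2 := ⟨!![X 0 0, X 0 1 ^ 2 * L 0 1; X 1 0 ^ 2 * L 1 0,
    X 1 1 - X 0 1 * X 1 0 * L 1 1 + X 1 1 * X 0 1 * L 0 1 * X 1 0 * L 1 0], by
      rw [det_fin_two_of]
      rw [ha] at hdL
      generalize X 0 0 = a at *
      generalize X 0 1 = b at *
      generalize X 1 0 = c at *
      generalize X 1 1 = e at *
      generalize L 0 1 = b1 at *
      generalize L 1 0 = c1 at *
      generalize L 1 1 = e1 at *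
      clear hX hL hL' ha hb
      grind⟩
  have hL₀ : IsCongrOne (2 * (d : ℤ) ^ 2) L₀ := by
    refine ⟨hX.1, hL.2.1.mul_left _, hL.2.2.1.mul_left _, ?_⟩
    have e : L₀ 1 1 - 1 =
        (X 1 1 - 1) - X 0 1 * (X 1 0 * L 1 1 - X 1 1 * L 0 1 * X 1 0 * L 1 0) := by
      change X 1 1 - X 0 1 * X 1 0 * L 1 1 + X 1 1 * X 0 1 * L 0 1 * X 1 0 * L 1 0 - 1 = _
      ring
    rw [e]
    exact dvd_sub hX.2.2.2 (hX.2.1.mul_right _)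
  rw [kills₁.eq_of_row hL₀ hL' ha' (by rw [hb]; exact (sub_self (X 0 1 ^ 2 * L 0 1)) ▸ dvd_zero _)]
  have h := congr_arg (QuotientGroup.mk' ⁅Gamma 2 d, Gamma 2 d⁆)
    (long_levi_relation X L L₀ ha rfl rfl rfl rfl)
  simp only [map_mul] at h
  have one {x : SpZ 2} (hx : x ∈ ⁅Gamma 2 d, Gamma 2 d⁆) :
    QuotientGroup.mk' ⁅Gamma 2 d, Gamma 2 d⁆ x = 1 := (QuotientGroup.eq_one_iff x).mpr hx
  rw [one (longTwo_lower_mem (dvd_neg.mpr (hL.2.2.1.mul_left _))),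
    one (siegelLower_mem hd (hq (hL.2.2.1.mul_left _))),
    one (levi_upper_mem hd (hq (dvd_neg.mpr hX.2.1))),
    one (levi_lower_mem hd (hq (dvd_neg.mpr hX.2.2.1))),
    one (siegelUpper_mem hd (hq (dvd_neg.mpr (hL.2.1.mul_left _)))),
    one (longTwo_upper_mem (dvd_neg.mpr (hL.2.1.mul_left _)))] at h
  simpa using h.symm

lemma longTwo_mem_of_isCongrOne {d : ℕ} (hd : Even d) (hd0 : d ≠ 0) {M : SL2}
    (hM : IsCongrOne (2 * (d : ℤ) ^ 2) M) : longTwo M ∈ ⁅Gamma 2 d, Gamma 2 d⁆ := by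
  refine (QuotientGroup.eq_one_iff _).mp ((symbolData_commutator hd).long_eq_one ?_ ?_ hM)
  · positivity
  · obtain ⟨e, rfl⟩ := hd
    exact ⟨2 * e ^ 2, by push_cast; ring⟩

/-- The commutator `⁅upperUni x, lowerUni x⁆`, see `commutator_upperUni_lowerUni`. -/
def commutatorUni (x : ℤ) : SL2 :=
  ⟨!![1 + x ^ 2 + x ^ 4, -x ^ 3; x ^ 3, 1 - x ^ 2], by rw [det_fin_two_of]; ring⟩

open scoped commutatorElement in
lemma commutator_upperUni_lowerUni (x : ℤ) : ⁅upperUni x, lowerUni x⁆ = commutatorUni x := by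
  rw [commutatorElement_def, mul_inv_eq_iff_eq_mul, mul_inv_eq_iff_eq_mul]
  apply SL2_ext <;> simp only [SL2_mul_apply] <;> simp [upperUni, lowerUni, commutatorUni] <;> ring

open scoped commutatorElement in
lemma longTwo_mem {d : ℕ} (hd : Even d) (hd0 : d ≠ 0) {M : SL2}
    (h00 : (d : ℤ) ^ 2 ∣ M 0 0 - 1) (h01 : 2 * (d : ℤ) ^ 2 ∣ M 0 1)
    (h10 : 2 * (d : ℤ) ^ 2 ∣ M 1 0) : longTwo M ∈ ⁅Gamma 2 d, Gamma 2 d⁆ := by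
  have aux : ∀ {M : SL2}, 2 * (d : ℤ) ^ 2 ∣ M 0 0 - 1 → 2 * (d : ℤ) ^ 2 ∣ M 0 1 →
      2 * (d : ℤ) ^ 2 ∣ M 1 0 → longTwo M ∈ ⁅Gamma 2 d, Gamma 2 d⁆ := by
    intro M h1 h2 h3
    refine longTwo_mem_of_isCongrOne hd hd0 ⟨h1, h2, h3, ?_⟩
    have e : M 1 1 - 1 = M 0 1 * M 1 0 - (M 0 0 - 1) * M 1 1 := by
      linear_combination SL2_det M
    rw [e]
    exact dvd_sub (h2.mul_right _) (h1.mul_right _)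
  obtain ⟨u, hu⟩ := h00
  rcases Int.even_or_odd' u with ⟨k, hk | hk⟩
  · exact aux ⟨k, by rw [hu, hk]; ring⟩ h01 h10
  let K : SL2 := ⁅upperUni d, lowerUni d⁆
  have hK : longTwo K ∈ ⁅Gamma 2 d, Gamma 2 d⁆ := by
    rw [map_commutatorElement]
    exact Subgroup.commutator_mem_commutator
      (mem_Gamma_of_longTwo (isCongrOne_upperUni dvd_rfl))
      (mem_Gamma_of_longTwo (isCongrOne_lowerUni dvd_rfl))
  have hKe : K = commutatorUni d := commutator_upperUni_lowerUni d
  refine (Subgroup.mul_mem_cancel_right _ hK).mp ?_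
  rw [← map_mul]
  obtain ⟨e, he⟩ := hd
  obtain ⟨v, hv⟩ := h01
  obtain ⟨w, hw⟩ := h10
  have hde : (d : ℤ) = 2 * e := by rw [he]; push_cast; ring
  have ha : M 0 0 = 1 + (d : ℤ) ^ 2 * (2 * k + 1) := by rw [← hk, ← hu]; ring
  apply aux
  · refine ⟨(1 + k + d * e + (2 * k + 1) * (d * e) * (1 + d ^ 2)) + v * d ^ 3, ?_⟩
    rw [SL2_mul_apply, hKe, ha, hv]
    simp [commutatorUni]
    linear_combination (-(d : ℤ) ^ 3  * (1 + (2 * k + 1) * (1 + d ^ 2))) * (-hde)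
  · refine ⟨- M 0 0 * e + v * (1 - d ^ 2), ?_⟩
    rw [SL2_mul_apply, hKe, hv]
    simp [commutatorUni]
    linear_combination (-(d : ℤ) ^ 2  * M 0 0) * hde
  · refine ⟨w * (1 + (d : ℤ) ^ 2 + d ^ 4) + M 1 1 * e, ?_⟩
    rw [SL2_mul_apply, hKe, hw]
    simp [commutatorUni]
    linear_combination ((d : ℤ) ^ 2  * M 1 1) * hde

open Sum in
lemma longOne_mulVec (M : SL2) (v : Idx 2 → ℤ) : (longOne M : Matrix (Idx 2) (Idx 2) ℤ) *ᵥ v =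
    Sum.elim ![M 0 0 * v (inl 0) + M 0 1 * v (inr 0), v (inl 1)]
      ![M 1 0 * v (inl 0) + M 1 1 * v (inr 0), v (inr 1)] := by
  ext (i | i) <;> fin_cases i <;> simp [longOne, mulVec, dotProduct, Fin.sum_univ_two]

open Sum in
lemma longTwo_mulVec (M : SL2) (v : Idx 2 → ℤ) : (longTwo M : Matrix (Idx 2) (Idx 2) ℤ) *ᵥ v =
    Sum.elim ![v (inl 0), M 0 0 * v (inl 1) + M 0 1 * v (inr 1)]
      ![v (inr 0), M 1 0 * v (inl 1) + M 1 1 * v (inr 1)] := by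
  ext (i | i) <;> fin_cases i <;> simp [longTwo, mulVec, dotProduct, Fin.sum_univ_two]

open Sum in
lemma levi_mulVec (M : SL2) (v : Idx 2 → ℤ) : (levi M : Matrix (Idx 2) (Idx 2) ℤ) *ᵥ v =
    Sum.elim ![M 0 0 * v (inl 0) + M 0 1 * v (inl 1), M 1 0 * v (inl 0) + M 1 1 * v (inl 1)]
      ![M 1 1 * v (inr 0) - M 1 0 * v (inr 1), M 0 0 * v (inr 1) - M 0 1 * v (inr 0)] := by
  ext (i | i) <;> fin_cases i <;> simp [levi, mulVec, dotProduct, Fin.sum_univ_two] <;> ring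

open Sum in
lemma siegelUpper_mulVec (t : ℤ) (v : Idx 2 → ℤ) :
    (siegelUpper t : Matrix (Idx 2) (Idx 2) ℤ) *ᵥ v =
    Sum.elim ![v (inl 0) + t * v (inr 1), v (inl 1) + t * v (inr 0)] ![v (inr 0), v (inr 1)] := by
  ext (i | i) <;> fin_cases i <;> simp [siegelUpper, mulVec, dotProduct, Fin.sum_univ_two]

open Sum in
lemma siegelLower_mulVec (t : ℤ) (v : Idx 2 → ℤ) :
    (siegelLower t : Matrix (Idx 2) (Idx 2) ℤ) *ᵥ v =
    Sum.elim ![v (inl 0), v (inl 1)] ![v (inr 0) + t * v (inl 1), v (inr 1) + t * v (inl 0)] := by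
  ext (i | i) <;> fin_cases i <;> simp [siegelLower, mulVec, dotProduct, Fin.sum_univ_two] <;> ring

lemma coe_mul_mulVec {g : ℕ} (A B : SpZ g) (v : Idx g → ℤ) :
    ((A * B : SpZ g) : Matrix (Idx g) (Idx g) ℤ) *ᵥ v =
      (A : Matrix (Idx g) (Idx g) ℤ) *ᵥ ((B : Matrix (Idx g) (Idx g) ℤ) *ᵥ v) := by
  rw [Submonoid.coe_mul, mulVec_mulVec]

/-- The elements of `Γ_g[d², 2d²]` lying in the commutator subgroup of `Γ_g[d]`. -/
def commGammaMod (g : ℕ) {d : ℕ} (hd : Even d) : Subgroup (SpZ g) :=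
  ⁅Gamma g d, Gamma g d⁆ ⊓ GammaMod g (d ^ 2) (by rw [pow_two]; exact hd.mul_right d)

lemma mem_GammaMod_sq_iff {g d : ℕ} {h : Even (d ^ 2)} {A : SpZ g} :
    A ∈ GammaMod g (d ^ 2) h ↔
      (∀ x y : Idx g, (d : ℤ) ^ 2 ∣ ((A : Matrix (Idx g) (Idx g) ℤ) -
        (1 : Matrix (Idx g) (Idx g) ℤ)) x y) ∧
      ∀ i : Fin g, 2 * (d : ℤ) ^ 2 ∣ (A : Matrix (Idx g) (Idx g) ℤ) (Sum.inl i) (Sum.inr i) ∧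
        2 * (d : ℤ) ^ 2 ∣ (A : Matrix (Idx g) (Idx g) ℤ) (Sum.inr i) (Sum.inl i) := by
  change A ∈ Gamma g (d ^ 2) ∧ (∀ i : Fin g, _ ∧ _) ↔ _
  rw [mem_Gamma_iff]
  push_cast
  rfl

section Moves

variable {d : ℕ} (hd : Even d)

lemma longOne_upper_mem_commGammaMod {t : ℤ} (ht : 2 * (d : ℤ) ^ 2 ∣ t) :
    longOne (upperUni t) ∈ commGammaMod 2 hd := by
  refine ⟨longOne_upper_mem ht, mem_GammaMod_sq_iff.mpr ⟨?_, fun i => ?_⟩⟩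
  · have := (dvd_mul_left _ _).trans ht
    rintro (i | i) (j | j) <;> fin_cases i <;> fin_cases j <;>
      simp [longOne, upperUni, *]
  · fin_cases i <;> simp [longOne, upperUni, *]

lemma longTwo_mem_commGammaMod (hd0 : d ≠ 0) {M : SL2}
    (h00 : (d : ℤ) ^ 2 ∣ M 0 0 - 1) (h01 : 2 * (d : ℤ) ^ 2 ∣ M 0 1)
    (h10 : 2 * (d : ℤ) ^ 2 ∣ M 1 0) : longTwo M ∈ commGammaMod 2 hd := by
  refine ⟨longTwo_mem hd hd0 h00 h01 h10, mem_GammaMod_sq_iff.mpr ⟨?_, fun i => ?_⟩⟩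
  · have h01' := (dvd_mul_left _ _).trans h01
    have h10' := (dvd_mul_left _ _).trans h10
    have h11 : (d : ℤ) ^ 2 ∣ M 1 1 - 1 := by
      have e : M 1 1 - 1 = M 0 1 * M 1 0 - (M 0 0 - 1) * M 1 1 := by
        linear_combination SL2_det M
      rw [e]
      exact dvd_sub (h01'.mul_right _) (h00.mul_right _)
    rintro (i | i) (j | j) <;> fin_cases i <;> fin_cases j <;>
      simp [longTwo, *]
  · fin_cases i <;> simp [longTwo, *]

lemma siegelUpper_mem_commGammaMod {t : ℤ} (ht : (d : ℤ) ^ 2 ∣ t) :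
    siegelUpper t ∈ commGammaMod 2 hd := by
  refine ⟨siegelUpper_mem hd ht, mem_GammaMod_sq_iff.mpr ⟨?_, fun i => ?_⟩⟩
  · rintro (i | i) (j | j) <;> fin_cases i <;> fin_cases j <;>
      simp [siegelUpper, *]
  · fin_cases i <;> simp [siegelUpper]

lemma siegelLower_mem_commGammaMod {t : ℤ} (ht : (d : ℤ) ^ 2 ∣ t) :
    siegelLower t ∈ commGammaMod 2 hd := by
  refine ⟨siegelLower_mem hd ht, mem_GammaMod_sq_iff.mpr ⟨?_, fun i => ?_⟩⟩
  · rintro (i | i) (j | j) <;> fin_cases i <;> fin_cases j <;>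
      simp [siegelLower, *]
  · fin_cases i <;> simp [siegelLower]

lemma levi_upper_mem_commGammaMod {t : ℤ} (ht : (d : ℤ) ^ 2 ∣ t) :
    levi (upperUni t) ∈ commGammaMod 2 hd := by
  refine ⟨levi_upper_mem hd ht, mem_GammaMod_sq_iff.mpr ⟨?_, fun i => ?_⟩⟩
  · rintro (i | i) (j | j) <;> fin_cases i <;> fin_cases j <;>
      simp [levi, upperUni, *]
  · fin_cases i <;> simp [levi, upperUni]

lemma levi_lower_mem_commGammaMod {t : ℤ} (ht : (d : ℤ) ^ 2 ∣ t) :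
    levi (lowerUni t) ∈ commGammaMod 2 hd := by
  refine ⟨levi_lower_mem hd ht, mem_GammaMod_sq_iff.mpr ⟨?_, fun i => ?_⟩⟩
  · rintro (i | i) (j | j) <;> fin_cases i <;> fin_cases j <;>
      simp [levi, lowerUni, *]
  · fin_cases i <;> simp [levi, lowerUni]

end Moves

lemma exists_dvd_of_dvd_add_mul {m : ℤ} (hm : m ≠ 0) (x y : ℤ) :
    ∃ s : ℤ, ∀ k, k ∣ x + s * y → k ∣ m → k ∣ x ∧ k ∣ y := by
  rcases eq_or_ne y 0 with rfl | hy
  · exact ⟨0, fun k h _ => by simpa using h⟩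
  obtain ⟨g, x, y, -, hxy, rfl, rfl⟩ := Int.exists_gcd_one' (m := x) (n := y)
    (Int.gcd_pos_of_ne_zero_right _ hy)
  have hy0 : y ≠ 0 := by rintro rfl; simp at hy
  obtain ⟨p, hpm, hp, hmod⟩ := Nat.forall_exists_prime_gt_and_zmodEq m.natAbs
    (q := y.natAbs) (a := x) (by simpa) (by
      rw [Int.natCast_natAbs]
      exact (Int.isCoprime_iff_gcd_eq_one.mpr hxy).abs_right)
  obtain ⟨s, hs⟩ := Int.natAbs_dvd.mp hmod.symm.dvd
  refine ⟨s, fun k h hkm => ?_⟩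
  have hpk : IsCoprime (p : ℤ) k := by
    refine (Nat.prime_iff_prime_int.mp hp).coprime_iff_not_dvd.mpr fun hpk => ?_
    exact absurd (Int.le_of_dvd (by positivity) ((dvd_abs _ _).mpr (hpk.trans hkm)))
      (by rw [not_le, Int.abs_eq_natAbs]; exact_mod_cast hpm)
  have e : x * g + s * (y * g) = p * g := by linear_combination (-(g : ℤ)) * hs
  rw [e] at h
  have hkg := hpk.symm.dvd_of_dvd_mul_left h
  exact ⟨hkg.mul_left _, hkg.mul_left _⟩

section Reduce

open Sum

variable {d : ℕ} (hd : Even d)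

lemma exists_dvd_of_dvd_pair {v : Idx 2 → ℤ} (hv0 : v (inl 1) ≠ 0)
    (hv : (d : ℤ) ^ 2 ∣ v (inl 1) - 1) :
    ∃ r ∈ commGammaMod 2 hd, ∀ k, k ∣ ((r : Matrix (Idx 2) (Idx 2) ℤ) *ᵥ v) (inl 1) →
      k ∣ ((r : Matrix (Idx 2) (Idx 2) ℤ) *ᵥ v) (inr 1) → ∀ y, k ∣ v y := by
  have hcop : ∀ {k}, k ∣ v (inl 1) → IsCoprime k (2 * (d : ℤ) ^ 2) := by
    intro k hk
    have h1 : IsCoprime k ((d : ℤ) ^ 2) := (isCoprime_level hv).of_isCoprime_of_dvd_left hk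
    have h2 : IsCoprime k 2 := (IsCoprime.pow_right_iff two_pos).mp h1 |>.of_isCoprime_of_dvd_right
      (by exact_mod_cast hd.two_dvd)
    exact h2.mul_right h1
  obtain ⟨s, hs⟩ := exists_dvd_of_dvd_add_mul hv0 (v (inl 0)) (2 * (d : ℤ) ^ 2 * v (inr 0))
  obtain ⟨s', hs'⟩ := exists_dvd_of_dvd_add_mul hv0 (v (inr 1))
    ((d : ℤ) ^ 2 * (v (inl 0) + s * (2 * (d : ℤ) ^ 2 * v (inr 0))))
  refine ⟨siegelLower ((d : ℤ) ^ 2 * s') * longOne (upperUni (2 * (d : ℤ) ^ 2 * s)),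
    mul_mem (siegelLower_mem_commGammaMod hd (dvd_mul_right _ _))
      (longOne_upper_mem_commGammaMod hd (dvd_mul_right _ _)),
    fun k h1 h2 => ?_⟩
  rw [coe_mul_mulVec, siegelLower_mulVec, longOne_mulVec] at h1 h2
  simp only [elim_inl, elim_inr, cons_val_zero, cons_val_one, upperUni_apply] at h1 h2
  obtain ⟨h3, h4⟩ := hs' k (by convert h2 using 1; ring) h1
  obtain ⟨h5, h6⟩ := hs k ((hcop h1).of_mul_right_right.dvd_of_dvd_mul_left h4) h1
  have h7 := (hcop h1).dvd_of_dvd_mul_left h6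
  rintro (i | i) <;> fin_cases i <;> assumption

lemma exists_longTwo_eq_one (hd0 : d ≠ 0) {v : Idx 2 → ℤ} (hv : (d : ℤ) ^ 2 ∣ v (inl 1) - 1)
    (hv' : 2 * (d : ℤ) ^ 2 ∣ v (inr 1)) (hcop : IsCoprime (v (inl 1)) (v (inr 1))) :
    ∃ M : SL2, longTwo M ∈ commGammaMod 2 hd ∧
      ((longTwo M : Matrix (Idx 2) (Idx 2) ℤ) *ᵥ v) (inl 1) = 1 := by
  have h2 : IsCoprime (v (inl 1)) (2 * (d : ℤ) ^ 2) := hcop.of_isCoprime_of_dvd_right hv'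
  obtain ⟨x, y, hxy⟩ := hcop.mul_right h2
  obtain ⟨M, h00, h01, h10⟩ : ∃ M : SL2, M 0 0 = x ∧ M 0 1 = y * (2 * (d : ℤ) ^ 2) ∧
      M 1 0 = -v (inr 1) :=
    ⟨⟨!![x, y * (2 * (d : ℤ) ^ 2); -v (inr 1), v (inl 1)], by
      rw [det_fin_two_of]; linear_combination hxy⟩, rfl, rfl, rfl⟩
  refine ⟨M, longTwo_mem_commGammaMod hd hd0 ?_ (h01 ▸ dvd_mul_left _ _)
    (h10 ▸ dvd_neg.mpr hv'), ?_⟩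
  · refine (isCoprime_level hv).symm.dvd_of_dvd_mul_right (z := v (inl 1)) ?_
    rw [h00]
    have e : (x - 1) * v (inl 1) = - (v (inl 1) - 1) - (d : ℤ) ^ 2 * (2 * y * v (inr 1)) := by
      linear_combination hxy
    rw [e]
    exact dvd_sub (dvd_neg.mpr hv) (dvd_mul_right _ _)
  · rw [longTwo_mulVec, h00, h01]
    simp only [elim_inl, cons_val_one, cons_val_fin_one]
    linear_combination hxy

lemma exists_clear_of_inl_eq_one {v : Idx 2 → ℤ} (hv : v (inl 1) = 1)
    (hv' : ∀ x, x ≠ inl 1 → (d : ℤ) ^ 2 ∣ v x) :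
    ∃ r ∈ commGammaMod 2 hd, ((r : Matrix (Idx 2) (Idx 2) ℤ) *ᵥ v) (inl 1) = 1 ∧
      ((r : Matrix (Idx 2) (Idx 2) ℤ) *ᵥ v) (inl 0) = 0 ∧
      ((r : Matrix (Idx 2) (Idx 2) ℤ) *ᵥ v) (inr 0) = 0 := by
  refine ⟨siegelLower (-v (inr 0)) * levi (upperUni (-v (inl 0))),
    mul_mem (siegelLower_mem_commGammaMod hd (dvd_neg.mpr (hv' _ (by simp))))
      (levi_upper_mem_commGammaMod hd (dvd_neg.mpr (hv' _ (by simp)))), ?_⟩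
  rw [coe_mul_mulVec, siegelLower_mulVec, levi_mulVec]
  simp [upperUni_apply, hv]

lemma exists_clear_of_inr_eq_one {v : Idx 2 → ℤ} (hv : v (inr 1) = 1)
    (hv' : ∀ x, x ≠ inr 1 → (d : ℤ) ^ 2 ∣ v x) :
    ∃ r ∈ commGammaMod 2 hd,
      (r : Matrix (Idx 2) (Idx 2) ℤ) *ᵥ Pi.single (inl 1) 1 = Pi.single (inl 1) 1 ∧
      ((r : Matrix (Idx 2) (Idx 2) ℤ) *ᵥ v) (inr 1) = 1 ∧
      ((r : Matrix (Idx 2) (Idx 2) ℤ) *ᵥ v) (inl 0) = 0 ∧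
      ((r : Matrix (Idx 2) (Idx 2) ℤ) *ᵥ v) (inr 0) = 0 := by
  refine ⟨levi (lowerUni (v (inr 0))) * siegelUpper (-v (inl 0)),
    mul_mem (levi_lower_mem_commGammaMod hd (hv' _ (by simp)))
      (siegelUpper_mem_commGammaMod hd (dvd_neg.mpr (hv' _ (by simp)))), ?_⟩
  simp only [coe_mul_mulVec, siegelUpper_mulVec, levi_mulVec]
  refine ⟨?_, by simp [lowerUni_apply, hv]⟩
  ext (i | i) <;> fin_cases i <;> simp [lowerUni_apply]

end Reduce

section Embedding

variable {h g : ℕ}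

/-- The matrix of the inclusion `ℤ^{2h} → ℤ^{2g}` determined by `f`. -/
def inclusionMatrix (f : Fin h ↪ Fin g) : Matrix (Idx g) (Idx h) ℤ :=
  fromBlocks ((1 : Matrix (Fin g) (Fin g) ℤ).submatrix id f) 0 0
    ((1 : Matrix (Fin g) (Fin g) ℤ).submatrix id f)

variable (f : Fin h ↪ Fin g)

lemma inclusionMatrix_apply (x : Idx g) (a : Idx h) :
    inclusionMatrix f x a = (1 : Matrix (Idx g) (Idx g) ℤ) x (Sum.map f f a) := by
  rcases x with x | x <;> rcases a with a | a <;>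
    simp [inclusionMatrix, Matrix.one_apply]

lemma inclusionMatrix_transpose_mul : (inclusionMatrix f)ᵀ * inclusionMatrix f = 1 := by
  ext a b
  simp [Matrix.mul_apply, inclusionMatrix_apply, Matrix.one_apply,
    (Sum.map_injective.mpr ⟨f.injective, f.injective⟩).eq_iff, eq_comm]

lemma J_mul_inclusionMatrix :
    Matrix.J (Fin g) ℤ * inclusionMatrix f = inclusionMatrix f * Matrix.J (Fin h) ℤ := by
  simp [Matrix.J, inclusionMatrix, fromBlocks_multiply]

lemma inclusionMatrix_transpose_mul_J :
    (inclusionMatrix f)ᵀ * Matrix.J (Fin g) ℤ = Matrix.J (Fin h) ℤ * (inclusionMatrix f)ᵀ := by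
  simp [Matrix.J, inclusionMatrix, fromBlocks_multiply, fromBlocks_transpose]

/-- The embedding `Sp(2h; ℤ) → Sp(2g; ℤ)` determined by an embedding of index sets. -/
def spEmbedding : SpZ h →* SpZ g where
  toFun A := ⟨1 + inclusionMatrix f * ((A : Matrix (Idx h) (Idx h) ℤ) - 1) *
      (inclusionMatrix f)ᵀ, by
    have hA := SymplecticGroup.mem_iff.mp A.2
    have h1 := inclusionMatrix_transpose_mul f
    have h2 := J_mul_inclusionMatrix f
    have h3 := inclusionMatrix_transpose_mul_J f
    generalize inclusionMatrix f = P at *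
    obtain ⟨B, hB⟩ : ∃ B, (A : Matrix (Idx h) (Idx h) ℤ) = 1 + B := ⟨A - 1, by abel⟩
    rw [hB] at hA
    rw [SymplecticGroup.mem_iff, hB, add_sub_cancel_left]
    generalize Matrix.J (Fin g) ℤ = Jg at *
    generalize Matrix.J (Fin h) ℤ = Jh at *
    simp only [transpose_add, transpose_one, transpose_mul, transpose_transpose, add_mul, mul_add,
      one_mul, mul_one] at hA ⊢
    have e : B * Jh + Jh * Bᵀ + B * Jh * Bᵀ = 0 := by
      rw [← sub_eq_zero] at hA
      rw [← hA]; abel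
    have e1 : P * B * Pᵀ * Jg = P * (B * Jh) * Pᵀ := by
      simp only [Matrix.mul_assoc, h3]
    have e2 : Jg * (P * (Bᵀ * Pᵀ)) = P * (Jh * Bᵀ) * Pᵀ := by
      rw [← Matrix.mul_assoc, h2]; simp only [Matrix.mul_assoc]
    have e3 : P * (B * Jh) * Pᵀ * (P * (Bᵀ * Pᵀ)) = P * (B * Jh * Bᵀ) * Pᵀ := by
      calc _ = P * (B * Jh) * (Pᵀ * P) * Bᵀ * Pᵀ := by simp only [Matrix.mul_assoc]
        _ = _ := by rw [h1, Matrix.mul_one]; simp only [Matrix.mul_assoc]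
    rw [e1, e2, e3]
    have : P * (B * Jh) * Pᵀ + P * (Jh * Bᵀ) * Pᵀ + P * (B * Jh * Bᵀ) * Pᵀ = 0 := by
      rw [← Matrix.add_mul, ← Matrix.mul_add, ← Matrix.add_mul, ← Matrix.mul_add, e]; simp
    rw [← sub_eq_zero, ← this]
    abel⟩
  map_one' := by
    apply Subtype.ext
    simp
  map_mul' A B := by
    apply Subtype.ext
    simp only [Submonoid.coe_mul]
    have h1 := inclusionMatrix_transpose_mul f
    generalize inclusionMatrix f = P at *
    generalize (A : Matrix (Idx h) (Idx h) ℤ) = A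
    generalize (B : Matrix (Idx h) (Idx h) ℤ) = B
    have e : P * (A - 1) * Pᵀ * (P * (B - 1) * Pᵀ) = P * ((A - 1) * (B - 1)) * Pᵀ := by
      calc _ = P * (A - 1) * (Pᵀ * P) * (B - 1) * Pᵀ := by simp only [Matrix.mul_assoc]
        _ = _ := by rw [h1, Matrix.mul_one]; simp only [Matrix.mul_assoc]
    rw [add_mul, one_mul, mul_add, mul_one, e]
    rw [show A * B - 1 = (B - 1) + ((A - 1) + (A - 1) * (B - 1)) by noncomm_ring]
    simp only [Matrix.mul_add, Matrix.add_mul]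
    abel

lemma spEmbedding_sub_one (A : SpZ h) :
    (spEmbedding f A : Matrix (Idx g) (Idx g) ℤ) - 1 =
      inclusionMatrix f * ((A : Matrix (Idx h) (Idx h) ℤ) - 1) * (inclusionMatrix f)ᵀ :=
  add_sub_cancel_left _ _

lemma spEmbedding_sub_one_apply (A : SpZ h) (x y : Idx g) :
    ((spEmbedding f A : Matrix (Idx g) (Idx g) ℤ) - 1) x y =
      ∑ b, ∑ a, inclusionMatrix f x a * ((A : Matrix (Idx h) (Idx h) ℤ) - 1) a b *
        inclusionMatrix f y b := by
  simp only [spEmbedding_sub_one, Matrix.mul_apply, Finset.sum_mul, transpose_apply]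

lemma spEmbedding_mulVec (A : SpZ h) (v : Idx g → ℤ) :
    (spEmbedding f A : Matrix (Idx g) (Idx g) ℤ) *ᵥ v =
      v + inclusionMatrix f *ᵥ ((A : Matrix (Idx h) (Idx h) ℤ) *ᵥ (v ∘ Sum.map f f) -
        v ∘ Sum.map f f) := by
  have e : (inclusionMatrix f)ᵀ *ᵥ v = v ∘ Sum.map f f := by
    ext a
    simp [mulVec, dotProduct, inclusionMatrix_apply, Matrix.one_apply]
  rw [← sub_add_cancel (spEmbedding f A : Matrix (Idx g) (Idx g) ℤ) 1, spEmbedding_sub_one,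
    add_mulVec, one_mulVec, ← mulVec_mulVec, ← mulVec_mulVec, e, sub_mulVec, one_mulVec, add_comm]

lemma spEmbedding_mulVec_comp (A : SpZ h) (v : Idx g → ℤ) :
    ((spEmbedding f A : Matrix (Idx g) (Idx g) ℤ) *ᵥ v) ∘ Sum.map f f =
      (A : Matrix (Idx h) (Idx h) ℤ) *ᵥ (v ∘ Sum.map f f) := by
  ext a
  rw [spEmbedding_mulVec]
  simp [mulVec, dotProduct, inclusionMatrix_apply, Matrix.one_apply,
    (Sum.map_injective.mpr ⟨f.injective, f.injective⟩).eq_iff]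

lemma spEmbedding_mulVec_apply_of_notMem (A : SpZ h) (v : Idx g → ℤ) {x : Idx g}
    (hx : Sum.elim id id x ∉ Set.range f) :
    ((spEmbedding f A : Matrix (Idx g) (Idx g) ℤ) *ᵥ v) x = v x := by
  rw [spEmbedding_mulVec]
  have : ∀ a, inclusionMatrix f x a = 0 := by
    intro a
    rw [inclusionMatrix_apply, Matrix.one_apply_ne]
    rintro rfl
    rcases a with a | a <;> simp at hx
  simp [mulVec, dotProduct, this]

lemma spEmbedding_mulVec_eq_self {A : SpZ h} {v : Idx g → ℤ}
    (hv : (A : Matrix (Idx h) (Idx h) ℤ) *ᵥ (v ∘ Sum.map f f) = v ∘ Sum.map f f) :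
    (spEmbedding f A : Matrix (Idx g) (Idx g) ℤ) *ᵥ v = v := by
  rw [spEmbedding_mulVec, hv]
  simp

lemma spEmbedding_mem_Gamma {d : ℕ} {A : SpZ h} (hA : A ∈ Gamma h d) :
    spEmbedding f A ∈ Gamma g d := by
  rw [mem_Gamma_iff] at hA ⊢
  intro x y
  rw [← Matrix.sub_apply, spEmbedding_sub_one_apply]
  exact Finset.dvd_sum fun b _ => Finset.dvd_sum fun a _ => ((hA a b).mul_left _).mul_right _

lemma spEmbedding_mem_commGammaMod {d : ℕ} (hd : Even d) {A : SpZ h} (hA : A ∈ commGammaMod h hd) :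
    spEmbedding f A ∈ commGammaMod g hd := by
  refine ⟨?_, ?_⟩
  · have := Subgroup.mem_map_of_mem (spEmbedding f) hA.1
    rw [Subgroup.map_commutator] at this
    have hle : (Gamma h d).map (spEmbedding f) ≤ Gamma g d := by
      rintro _ ⟨A, hA, rfl⟩
      exact spEmbedding_mem_Gamma f hA
    exact Subgroup.commutator_mono hle hle this
  · obtain ⟨h1, h2⟩ := mem_GammaMod_sq_iff.mp hA.2
    refine mem_GammaMod_sq_iff.mpr ⟨fun x y => ?_, fun i => ?_⟩
    · rw [spEmbedding_sub_one_apply]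
      exact Finset.dvd_sum fun b _ => Finset.dvd_sum fun a _ => ((h1 a b).mul_left _).mul_right _
    have key (x y : Idx g) (hxy : x ≠ y) (hdvd : ∀ a b, Sum.map f f a = x → Sum.map f f b = y →
        2 * (d : ℤ) ^ 2 ∣ ((A : Matrix (Idx h) (Idx h) ℤ) - 1) a b) :
        2 * (d : ℤ) ^ 2 ∣ (spEmbedding f A : Matrix (Idx g) (Idx g) ℤ) x y := by
      have := spEmbedding_sub_one_apply f A x y
      rw [Matrix.sub_apply, Matrix.one_apply_ne hxy, sub_zero] at this
      rw [this]
      refine Finset.dvd_sum fun b _ => Finset.dvd_sum fun a _ => ?_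
      by_cases ha : x = Sum.map f f a
      · by_cases hb : y = Sum.map f f b
        · exact ((hdvd a b ha.symm hb.symm).mul_left _).mul_right _
        · simp [inclusionMatrix_apply, Matrix.one_apply_ne hb]
      · simp [inclusionMatrix_apply, Matrix.one_apply_ne ha]
    constructor <;> refine key _ _ (by simp) ?_ <;> rintro (a | a) (b | b) ha hb <;> simp at ha hb
    · obtain rfl := f.injective (ha.trans hb.symm)
      simpa using (h2 a).1
    · obtain rfl := f.injective (ha.trans hb.symm)
      simpa using (h2 a).2

end Embedding

section Fixing

variable {g : ℕ}

/-- The subgroup of `Sp(2g; ℤ)` fixing a vector. -/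
def fixVec (w : Idx g → ℤ) : Subgroup (SpZ g) where
  carrier := {A | (A : Matrix (Idx g) (Idx g) ℤ) *ᵥ w = w}
  one_mem' := one_mulVec w
  mul_mem' {A B} hA hB := by
    change ((A * B : SpZ g) : Matrix (Idx g) (Idx g) ℤ) *ᵥ w = w
    rw [coe_mul_mulVec, show _ *ᵥ w = w from hB, show _ *ᵥ w = w from hA]
  inv_mem' {A} hA := by
    change ((A⁻¹ : SpZ g) : Matrix (Idx g) (Idx g) ℤ) *ᵥ w = w
    nth_rw 1 [← show _ *ᵥ w = w from hA]
    rw [← coe_mul_mulVec, inv_mul_cancel, Submonoid.coe_one, one_mulVec]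

lemma mem_fixVec {w : Idx g → ℤ} {A : SpZ g} :
    A ∈ fixVec w ↔ (A : Matrix (Idx g) (Idx g) ℤ) *ᵥ w = w := Iff.rfl

/-- The subgroup of `Sp(2g; ℤ)` fixing the standard basis vectors attached to indices
outside `T`. -/
def fixOff (T : Finset (Fin g)) : Subgroup (SpZ g) :=
  ⨅ (x : Idx g) (_ : Sum.elim id id x ∉ T), fixVec (Pi.single x 1)

lemma mem_fixOff {T : Finset (Fin g)} {A : SpZ g} :
    A ∈ fixOff T ↔ ∀ x : Idx g, Sum.elim id id x ∉ T →
      (A : Matrix (Idx g) (Idx g) ℤ) *ᵥ Pi.single x 1 = Pi.single x 1 := by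
  simp only [fixOff, Subgroup.mem_iInf, mem_fixVec]

lemma fixOff_empty : (fixOff ∅ : Subgroup (SpZ g)) = ⊥ := by
  rw [eq_bot_iff]
  intro A hA
  rw [mem_fixOff] at hA
  rw [Subgroup.mem_bot]
  apply Subtype.ext
  ext x y
  simpa [Matrix.one_apply, Pi.single_apply] using congr_fun (hA y (by simp)) x

lemma symplectic_form_mulVec (A : SpZ g) (v w : Idx g → ℤ) :
    ((A : Matrix (Idx g) (Idx g) ℤ) *ᵥ v) ⬝ᵥ
      (Matrix.J (Fin g) ℤ *ᵥ ((A : Matrix (Idx g) (Idx g) ℤ) *ᵥ w)) =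
      v ⬝ᵥ (Matrix.J (Fin g) ℤ *ᵥ w) := by
  have h := SymplecticGroup.mem_iff'.mp A.2
  rw [dotProduct_mulVec, ← vecMul_transpose, dotProduct_mulVec, vecMul_vecMul, vecMul_vecMul,
    ← Matrix.mul_assoc, h, ← dotProduct_mulVec]

lemma mulVec_inr_of_fix {A : SpZ g} {i : Fin g} (hA : (A : Matrix (Idx g) (Idx g) ℤ) *ᵥ
    Pi.single (Sum.inl i) 1 = Pi.single (Sum.inl i) 1) (v : Idx g → ℤ) :
    ((A : Matrix (Idx g) (Idx g) ℤ) *ᵥ v) (Sum.inr i) = v (Sum.inr i) := by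
  have h := symplectic_form_mulVec A v (Pi.single (Sum.inl i) 1)
  rw [hA] at h
  simpa [Matrix.J, dotProduct, Matrix.one_apply] using h

lemma mulVec_inl_of_fix {A : SpZ g} {i : Fin g} (hA : (A : Matrix (Idx g) (Idx g) ℤ) *ᵥ
    Pi.single (Sum.inr i) 1 = Pi.single (Sum.inr i) 1) (v : Idx g → ℤ) :
    ((A : Matrix (Idx g) (Idx g) ℤ) *ᵥ v) (Sum.inl i) = v (Sum.inl i) := by
  have h := symplectic_form_mulVec A v (Pi.single (Sum.inr i) 1)
  rw [hA] at h
  simpa [Matrix.J, dotProduct, Matrix.one_apply] using h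

lemma mulVec_apply_of_mem_fixOff {T : Finset (Fin g)} {A : SpZ g} (hA : A ∈ fixOff T)
    (v : Idx g → ℤ) {x : Idx g} (hx : Sum.elim id id x ∉ T) :
    ((A : Matrix (Idx g) (Idx g) ℤ) *ᵥ v) x = v x := by
  rw [mem_fixOff] at hA
  rcases x with i | i
  · exact mulVec_inl_of_fix (hA (Sum.inr i) hx) v
  · exact mulVec_inr_of_fix (hA (Sum.inl i) hx) v

lemma exists_mem_forall_clear (R : Subgroup (SpZ g)) (Good : (Idx g → ℤ) → Prop) {j : Fin g}
    (S : Finset (Fin g)) (hj : j ∉ S)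
    (step : ∀ i ∈ S, ∀ v, Good v → ∃ r ∈ R, Good ((r : Matrix (Idx g) (Idx g) ℤ) *ᵥ v) ∧
      ∀ x, Sum.elim id id x ≠ j → ((r : Matrix (Idx g) (Idx g) ℤ) *ᵥ v) x =
        if Sum.elim id id x = i then 0 else v x) {v : Idx g → ℤ} (hv : Good v) :
    ∃ r ∈ R, Good ((r : Matrix (Idx g) (Idx g) ℤ) *ᵥ v) ∧
      ∀ x, Sum.elim id id x ≠ j → ((r : Matrix (Idx g) (Idx g) ℤ) *ᵥ v) x =
        if Sum.elim id id x ∈ S then 0 else v x := by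
  induction S using Finset.induction_on with
  | empty => exact ⟨1, one_mem R, by simpa using hv, fun x _ => by simp⟩
  | insert i S hi ih =>
    obtain ⟨r, hr, hg, hx⟩ := ih (by grind) (fun i hi => step i (by grind))
    obtain ⟨r', hr', hg', hx'⟩ := step i (by grind) _ hg
    refine ⟨r' * r, mul_mem hr' hr, ?_, fun x hxj => ?_⟩
    · rwa [coe_mul_mulVec]
    · rw [coe_mul_mulVec, hx' x hxj, hx x hxj]
      grind

end Fixing

section Pair

variable {g : ℕ}

/-- The embedding `Fin 2 ↪ Fin g` with values `i` and `j`. -/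
def pairEmbedding {i j : Fin g} (h : i ≠ j) : Fin 2 ↪ Fin g :=
  ⟨![i, j], by intro a b; fin_cases a <;> fin_cases b <;> simp [h, h.symm]⟩

lemma pairEmbedding_mem {i j : Fin g} (hij : i ≠ j) {T : Finset (Fin g)} (hi : i ∈ T)
    (hj : j ∈ T) (a : Fin 2) : pairEmbedding hij a ∈ T := by
  fin_cases a
  · exact hi
  · exact hj

lemma map_pairEmbedding_injective {i j : Fin g} (hij : i ≠ j) :
    Function.Injective (Sum.map (pairEmbedding hij) (pairEmbedding hij)) :=
  Sum.map_injective.mpr ⟨(pairEmbedding hij).injective, (pairEmbedding hij).injective⟩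

lemma notMem_range_pairEmbedding {i j x : Fin g} (hij : i ≠ j) (hi : x ≠ i) (hj : x ≠ j) :
    x ∉ Set.range (pairEmbedding hij) := by
  rintro ⟨a, rfl⟩
  fin_cases a
  · exact hi rfl
  · exact hj rfl

lemma spEmbedding_longTwo_mulVec {i j : Fin g} (hij : i ≠ j) (M : SL2) (v : Idx g → ℤ) :
    ((spEmbedding (pairEmbedding hij) (longTwo M) : Matrix (Idx g) (Idx g) ℤ) *ᵥ v) (Sum.inl j) =
        M 0 0 * v (Sum.inl j) + M 0 1 * v (Sum.inr j) ∧
      ((spEmbedding (pairEmbedding hij) (longTwo M) : Matrix (Idx g) (Idx g) ℤ) *ᵥ v) (Sum.inr j) =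
        M 1 0 * v (Sum.inl j) + M 1 1 * v (Sum.inr j) ∧
      ∀ x, Sum.elim id id x ≠ j →
        ((spEmbedding (pairEmbedding hij) (longTwo M) : Matrix (Idx g) (Idx g) ℤ) *ᵥ v) x =
          v x := by
  have h := spEmbedding_mulVec_comp (pairEmbedding hij) (longTwo M) v
  rw [longTwo_mulVec] at h
  refine ⟨congr_fun h (Sum.inl 1), congr_fun h (Sum.inr 1), fun x hxj => ?_⟩
  by_cases hxi : Sum.elim id id x = i
  · rcases x with x | x <;> obtain rfl : x = i := hxi
    · exact congr_fun h (Sum.inl 0)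
    · exact congr_fun h (Sum.inr 0)
  · exact spEmbedding_mulVec_apply_of_notMem _ _ _ (notMem_range_pairEmbedding hij hxi hxj)

lemma spEmbedding_mem_fixOff {h : ℕ} {f : Fin h ↪ Fin g} {T : Finset (Fin g)} (hf : ∀ a, f a ∈ T)
    (A : SpZ h) : spEmbedding f A ∈ fixOff T := by
  refine mem_fixOff.mpr fun x hx => spEmbedding_mulVec_eq_self f ?_
  have : (Pi.single x 1 : Idx g → ℤ) ∘ Sum.map f f = 0 := by
    ext a
    refine Pi.single_eq_of_ne ?_ _
    rintro rfl
    rcases a with a | a <;> simp [hf] at hx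
  rw [this, mulVec_zero]

lemma spEmbedding_longTwo_mem_fixOff {i j : Fin g} (hij : i ≠ j) {T : Finset (Fin g)} (hj : j ∈ T)
    (M : SL2) : spEmbedding (pairEmbedding hij) (longTwo M) ∈ fixOff T := by
  refine mem_fixOff.mpr fun x hx => spEmbedding_mulVec_eq_self _ ?_
  have h1 : ((Pi.single x 1 : Idx g → ℤ) ∘ Sum.map (pairEmbedding hij) (pairEmbedding hij))
      (Sum.inl 1) = 0 := by
    refine Pi.single_eq_of_ne ?_ _
    rintro rfl
    exact hx hj
  have h2 : ((Pi.single x 1 : Idx g → ℤ) ∘ Sum.map (pairEmbedding hij) (pairEmbedding hij))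
      (Sum.inr 1) = 0 := by
    refine Pi.single_eq_of_ne ?_ _
    rintro rfl
    exact hx hj
  rw [longTwo_mulVec, h1, h2]
  ext (a | a) <;> fin_cases a
  · rfl
  · simpa using h1.symm
  · rfl
  · simpa using h2.symm

end Pair

section Reduction

open Sum

variable {g d : ℕ}

lemma dvd_mulVec_sub {h : Even (d ^ 2)} {A : SpZ g} (hA : A ∈ GammaMod g (d ^ 2) h)
    (v : Idx g → ℤ) (x : Idx g) :
    (d : ℤ) ^ 2 ∣ ((A : Matrix (Idx g) (Idx g) ℤ) *ᵥ v) x - v x := by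
  have e : ((A : Matrix (Idx g) (Idx g) ℤ) *ᵥ v) x - v x =
      (((A : Matrix (Idx g) (Idx g) ℤ) - 1) *ᵥ v) x := by
    rw [sub_mulVec, one_mulVec, Pi.sub_apply]
  rw [e, mulVec, dotProduct]
  exact Finset.dvd_sum fun y _ => ((mem_GammaMod_sq_iff.mp hA).1 x y).mul_right _

lemma dvd_mulVec_single_of_ne {h : Even (d ^ 2)} {A : SpZ g} (hA : A ∈ GammaMod g (d ^ 2) h)
    {y x : Idx g} (hx : x ≠ y) :
    (d : ℤ) ^ 2 ∣ ((A : Matrix (Idx g) (Idx g) ℤ) *ᵥ Pi.single y 1) x := by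
  have := dvd_mulVec_sub hA (Pi.single y 1) x
  rwa [Pi.single_eq_of_ne hx, sub_zero] at this

lemma dvd_mulVec_single_self_sub {h : Even (d ^ 2)} {A : SpZ g} (hA : A ∈ GammaMod g (d ^ 2) h)
    (y : Idx g) :
    (d : ℤ) ^ 2 ∣ ((A : Matrix (Idx g) (Idx g) ℤ) *ᵥ Pi.single y 1) y - 1 := by
  have := dvd_mulVec_sub hA (Pi.single y 1) y
  rwa [Pi.single_eq_same] at this

lemma two_mul_dvd_mulVec_single_inl {h : Even (d ^ 2)} {A : SpZ g}
    (hA : A ∈ GammaMod g (d ^ 2) h) (i : Fin g) :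
    2 * (d : ℤ) ^ 2 ∣ ((A : Matrix (Idx g) (Idx g) ℤ) *ᵥ Pi.single (inl i) 1) (inr i) := by
  simpa using ((mem_GammaMod_sq_iff.mp hA).2 i).2

lemma two_mul_dvd_mulVec_single_inr {h : Even (d ^ 2)} {A : SpZ g}
    (hA : A ∈ GammaMod g (d ^ 2) h) (i : Fin g) :
    2 * (d : ℤ) ^ 2 ∣ ((A : Matrix (Idx g) (Idx g) ℤ) *ᵥ Pi.single (inr i) 1) (inl i) := by
  simpa using ((mem_GammaMod_sq_iff.mp hA).2 i).1

lemma isUnit_of_dvd_mulVec_single (A : SpZ g) (y : Idx g) {k : ℤ}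
    (hk : ∀ x, k ∣ ((A : Matrix (Idx g) (Idx g) ℤ) *ᵥ Pi.single y 1) x) : IsUnit k := by
  refine isUnit_of_dvd_one ?_
  have h : ((A⁻¹ : SpZ g) : Matrix (Idx g) (Idx g) ℤ) *ᵥ
      ((A : Matrix (Idx g) (Idx g) ℤ) *ᵥ Pi.single y 1) = Pi.single y 1 := by
    rw [← coe_mul_mulVec, inv_mul_cancel, Submonoid.coe_one, one_mulVec]
  have h' := congr_fun h y
  rw [Pi.single_eq_same] at h'
  rw [← h', mulVec, dotProduct]
  exact Finset.dvd_sum fun x _ => (hk x).mul_left _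

variable (hd : Even d) {j : Fin g} {T : Finset (Fin g)}

lemma exists_isCoprime_column (hd0 : 2 ≤ d) {A : SpZ g}
    {h : Even (d ^ 2)} (hA : A ∈ GammaMod g (d ^ 2) h) (hAT : A ∈ fixOff (insert j T)) :
    ∃ r ∈ commGammaMod g hd ⊓ fixOff (insert j T),
      IsCoprime ((((r * A : SpZ g) : Matrix (Idx g) (Idx g) ℤ) *ᵥ Pi.single (inl j) 1) (inl j))
        ((((r * A : SpZ g) : Matrix (Idx g) (Idx g) ℤ) *ᵥ Pi.single (inl j) 1) (inr j)) := by
  let μ : SpZ g → ℕ := fun r =>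
    Int.gcd ((((r * A : SpZ g) : Matrix (Idx g) (Idx g) ℤ) *ᵥ Pi.single (inl j) 1) (inl j))
      ((((r * A : SpZ g) : Matrix (Idx g) (Idx g) ℤ) *ᵥ Pi.single (inl j) 1) (inr j))
  obtain ⟨r, hr, hmin⟩ := WellFounded.has_min (measure μ).wf
    ((commGammaMod g hd ⊓ fixOff (insert j T) : Subgroup (SpZ g)) : Set (SpZ g)) ⟨1, one_mem _⟩
  refine ⟨r, hr, ?_⟩
  have hB : r * A ∈ GammaMod g (d ^ 2) h := mul_mem hr.1.2 hA
  have hBT : r * A ∈ fixOff (insert j T) := mul_mem hr.2 hAT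
  have ha := dvd_mulVec_single_self_sub hB (inl j)
  have ha0 : (((r * A : SpZ g) : Matrix (Idx g) (Idx g) ℤ) *ᵥ Pi.single (inl j) 1) (inl j) ≠ 0 := by
    intro h0
    rw [h0, zero_sub, dvd_neg] at ha
    have := Int.le_of_dvd one_pos ha
    have : (2 : ℤ) ≤ d := by exact_mod_cast hd0
    nlinarith
  rw [Int.isCoprime_iff_gcd_eq_one]
  change μ r = 1
  have hμ0 : 0 < μ r := Int.gcd_pos_of_ne_zero_left _ ha0
  have key : ∀ i ∈ T, i ≠ j →
      ((μ r : ℕ) : ℤ) ∣ (((r * A : SpZ g) : Matrix (Idx g) (Idx g) ℤ) *ᵥ Pi.single (inl j) 1)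
        (inl i) ∧
      ((μ r : ℕ) : ℤ) ∣ (((r * A : SpZ g) : Matrix (Idx g) (Idx g) ℤ) *ᵥ Pi.single (inl j) 1)
        (inr i) := by
    intro i hi hij
    obtain ⟨r', hr', hk⟩ := exists_dvd_of_dvd_pair hd
      (v := (((r * A : SpZ g) : Matrix (Idx g) (Idx g) ℤ) *ᵥ Pi.single (inl j) 1) ∘
        Sum.map (pairEmbedding hij) (pairEmbedding hij)) ha0 ha
    rw [← spEmbedding_mulVec_comp, ← coe_mul_mulVec, ← mul_assoc] at hk
    specialize hk (μ (spEmbedding (pairEmbedding hij) r' * r) : ℤ) (Int.gcd_dvd_left _ _)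
      (Int.gcd_dvd_right _ _)
    have hle := hmin (spEmbedding (pairEmbedding hij) r' * r)
      (mul_mem ⟨spEmbedding_mem_commGammaMod _ hd hr', spEmbedding_mem_fixOff
        (pairEmbedding_mem hij (by simp [hi]) (by simp)) _⟩ hr)
    have hdvd : μ (spEmbedding (pairEmbedding hij) r' * r) ∣ μ r :=
      Int.natCast_dvd_natCast.mp (Int.dvd_coe_gcd (hk (inl 1)) (hk (inr 1)))
    rw [le_antisymm (Nat.le_of_dvd hμ0 hdvd) (not_lt.mp hle)] at hk
    exact ⟨hk (inl 0), hk (inr 0)⟩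
  have hall : ∀ x, ((μ r : ℕ) : ℤ) ∣
      (((r * A : SpZ g) : Matrix (Idx g) (Idx g) ℤ) *ᵥ Pi.single (inl j) 1) x := by
    intro x
    by_cases hxj : Sum.elim id id x = j
    · rcases x with x | x <;> obtain rfl : x = j := hxj
      · exact Int.gcd_dvd_left _ _
      · exact Int.gcd_dvd_right _ _
    by_cases hxT : Sum.elim id id x ∈ T
    · rcases x with x | x
      · exact (key x hxT hxj).1
      · exact (key x hxT hxj).2
    · rw [mulVec_apply_of_mem_fixOff hBT _ (by simp [hxj, hxT]), Pi.single_eq_of_ne]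
      · exact dvd_zero _
      · rintro rfl; exact hxj rfl
  simpa [Int.isUnit_iff_natAbs_eq] using isUnit_of_dvd_mulVec_single _ _ hall

lemma exists_fix_inl (hg : 2 ≤ g) (hd0 : 2 ≤ d) (hj : j ∉ T) {A : SpZ g}
    {h : Even (d ^ 2)} (hA : A ∈ GammaMod g (d ^ 2) h) (hAT : A ∈ fixOff (insert j T)) :
    ∃ r ∈ commGammaMod g hd ⊓ fixOff (insert j T),
      ((r * A : SpZ g) : Matrix (Idx g) (Idx g) ℤ) *ᵥ Pi.single (inl j) 1 =
        Pi.single (inl j) 1 := by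
  have : Nontrivial (Fin g) := Fin.nontrivial_iff_two_le.mpr hg
  obtain ⟨i₀, hi₀⟩ := exists_ne j
  obtain ⟨r₁, hr₁, hcop⟩ := exists_isCoprime_column hd hd0 hA hAT
  have hA₁ : r₁ * A ∈ GammaMod g (d ^ 2) h := mul_mem hr₁.1.2 hA
  obtain ⟨M, hM, hM1⟩ := exists_longTwo_eq_one hd (by lia)
    (v := (((r₁ * A : SpZ g) : Matrix (Idx g) (Idx g) ℤ) *ᵥ Pi.single (inl j) 1) ∘
        Sum.map (pairEmbedding hi₀) (pairEmbedding hi₀)) (dvd_mulVec_single_self_sub hA₁ _)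
    (two_mul_dvd_mulVec_single_inl hA₁ _) hcop
  rw [← spEmbedding_mulVec_comp, ← coe_mul_mulVec] at hM1
  have hr₂ : spEmbedding (pairEmbedding hi₀) (longTwo M) * r₁ ∈
      commGammaMod g hd ⊓ fixOff (insert j T) :=
    mul_mem ⟨spEmbedding_mem_commGammaMod _ hd hM,
      spEmbedding_longTwo_mem_fixOff hi₀ (by simp) M⟩ hr₁
  rw [← mul_assoc] at hM1
  generalize spEmbedding (pairEmbedding hi₀) (longTwo M) * r₁ = r₂ at hr₂ hM1
  have step : ∀ i ∈ T, ∀ v : Idx g → ℤ, (v (inl j) = 1 ∧ ∀ x, x ≠ inl j → (d : ℤ) ^ 2 ∣ v x) →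
      ∃ r ∈ commGammaMod g hd ⊓ fixOff (insert j T),
        (((r : Matrix (Idx g) (Idx g) ℤ) *ᵥ v) (inl j) = 1 ∧
          ∀ x, x ≠ inl j → (d : ℤ) ^ 2 ∣ ((r : Matrix (Idx g) (Idx g) ℤ) *ᵥ v) x) ∧
        ∀ x, Sum.elim id id x ≠ j → ((r : Matrix (Idx g) (Idx g) ℤ) *ᵥ v) x =
          if Sum.elim id id x = i then 0 else v x := by
    rintro i hi v ⟨hv1, hv2⟩
    have hij : i ≠ j := ne_of_mem_of_not_mem hi hj
    obtain ⟨r, hr, h1, h2, h3⟩ := exists_clear_of_inl_eq_one hd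
      (v := v ∘ Sum.map (pairEmbedding hij) (pairEmbedding hij)) hv1
      fun x hx => hv2 _ ((map_pairEmbedding_injective hij).ne hx)
    rw [← spEmbedding_mulVec_comp] at h1 h2 h3
    have hr' := spEmbedding_mem_commGammaMod (pairEmbedding hij) hd hr
    refine ⟨_, ⟨hr', spEmbedding_mem_fixOff (pairEmbedding_mem hij (by simp [hi]) (by simp)) _⟩,
      ⟨h1, fun x hx => (dvd_iff_dvd_of_dvd_sub (dvd_mulVec_sub hr'.2 v x)).mpr (hv2 x hx)⟩,
      fun x hx => ?_⟩
    split_ifs with hxi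
    · rcases x with x | x <;> obtain rfl : x = i := hxi
      · exact h2
      · exact h3
    · exact spEmbedding_mulVec_apply_of_notMem _ _ _ (notMem_range_pairEmbedding hij hxi hx)
  obtain ⟨r₃, hr₃, ⟨h31, -⟩, hclear⟩ := exists_mem_forall_clear _ _ T hj step
    ⟨hM1, fun x hx => dvd_mulVec_single_of_ne (mul_mem hr₂.1.2 hA) hx⟩
  have hA₃ : r₃ * (r₂ * A) ∈ GammaMod g (d ^ 2) h := mul_mem hr₃.1.2 (mul_mem hr₂.1.2 hA)
  obtain ⟨c, hc⟩ := two_mul_dvd_mulVec_single_inl hA₃ j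
  refine ⟨spEmbedding (pairEmbedding hi₀) (longTwo (lowerUni (-(2 * (d : ℤ) ^ 2 * c)))) * (r₃ * r₂),
    mul_mem ⟨spEmbedding_mem_commGammaMod _ hd (longTwo_mem_commGammaMod hd (by lia) ?_ ?_ ?_),
      spEmbedding_longTwo_mem_fixOff hi₀ (by simp) _⟩ (mul_mem hr₃ hr₂), ?_⟩
  · simp [lowerUni_apply]
  · simp [lowerUni_apply]
  · simp [lowerUni_apply]
  rw [mul_assoc (spEmbedding _ _), mul_assoc r₃, coe_mul_mulVec, coe_mul_mulVec]
  rw [coe_mul_mulVec] at hc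
  obtain ⟨h1, h2, h3⟩ := spEmbedding_longTwo_mulVec hi₀ (lowerUni (-(2 * (d : ℤ) ^ 2 * c)))
    ((r₃ : Matrix (Idx g) (Idx g) ℤ) *ᵥ
      (((r₂ * A : SpZ g) : Matrix (Idx g) (Idx g) ℤ) *ᵥ Pi.single (inl j) 1))
  ext x
  by_cases hxj : Sum.elim id id x = j
  · rcases x with x | x <;> obtain rfl : x = j := hxj
    · rw [h1, h31, hc]
      simp [lowerUni_apply]
    · rw [h2, h31, hc]
      simp [lowerUni_apply]
  · rw [h3 x hxj, hclear x hxj, Pi.single_eq_of_ne (by rintro rfl; exact hxj rfl)]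
    split_ifs with hxT
    · rfl
    · rw [mulVec_apply_of_mem_fixOff (mul_mem hr₂.2 hAT) _ (by simp [hxj, hxT]),
        Pi.single_eq_of_ne (by rintro rfl; exact hxj rfl)]

lemma exists_fix_inr (hg : 2 ≤ g) (hd0 : 2 ≤ d) (hj : j ∉ T) {A : SpZ g}
    {h : Even (d ^ 2)} (hA : A ∈ GammaMod g (d ^ 2) h) (hAT : A ∈ fixOff (insert j T))
    (hAj : (A : Matrix (Idx g) (Idx g) ℤ) *ᵥ Pi.single (inl j) 1 = Pi.single (inl j) 1) :
    ∃ r ∈ commGammaMod g hd ⊓ fixOff (insert j T),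
      ((r * A : SpZ g) : Matrix (Idx g) (Idx g) ℤ) *ᵥ Pi.single (inl j) 1 =
        Pi.single (inl j) 1 ∧
      ((r * A : SpZ g) : Matrix (Idx g) (Idx g) ℤ) *ᵥ Pi.single (inr j) 1 =
        Pi.single (inr j) 1 := by
  have : Nontrivial (Fin g) := Fin.nontrivial_iff_two_le.mpr hg
  obtain ⟨i₀, hi₀⟩ := exists_ne j
  have step : ∀ i ∈ T, ∀ v : Idx g → ℤ, (v (inr j) = 1 ∧ ∀ x, x ≠ inr j → (d : ℤ) ^ 2 ∣ v x) →
      ∃ r ∈ commGammaMod g hd ⊓ fixOff (insert j T) ⊓ fixVec (Pi.single (inl j) 1),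
        (((r : Matrix (Idx g) (Idx g) ℤ) *ᵥ v) (inr j) = 1 ∧
          ∀ x, x ≠ inr j → (d : ℤ) ^ 2 ∣ ((r : Matrix (Idx g) (Idx g) ℤ) *ᵥ v) x) ∧
        ∀ x, Sum.elim id id x ≠ j → ((r : Matrix (Idx g) (Idx g) ℤ) *ᵥ v) x =
          if Sum.elim id id x = i then 0 else v x := by
    rintro i hi v ⟨hv1, hv2⟩
    have hij : i ≠ j := ne_of_mem_of_not_mem hi hj
    obtain ⟨r, hr, h0, h1, h2, h3⟩ := exists_clear_of_inr_eq_one hd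
      (v := v ∘ Sum.map (pairEmbedding hij) (pairEmbedding hij)) hv1
      fun x hx => hv2 _ ((map_pairEmbedding_injective hij).ne hx)
    rw [← spEmbedding_mulVec_comp] at h1 h2 h3
    have hr' := spEmbedding_mem_commGammaMod (pairEmbedding hij) hd hr
    have hsingle : (Pi.single (inl j) 1 : Idx g → ℤ) ∘
        Sum.map (pairEmbedding hij) (pairEmbedding hij) = Pi.single (inl 1) 1 := by
      ext a
      simp only [Function.comp_apply, Pi.single_apply]
      exact if_congr ((map_pairEmbedding_injective hij).eq_iff' rfl) rfl rfl
    refine ⟨_, ⟨⟨hr', spEmbedding_mem_fixOff (pairEmbedding_mem hij (by simp [hi]) (by simp)) _⟩,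
      spEmbedding_mulVec_eq_self _ (by rw [hsingle, h0])⟩,
      ⟨h1, fun x hx => (dvd_iff_dvd_of_dvd_sub (dvd_mulVec_sub hr'.2 v x)).mpr (hv2 x hx)⟩,
      fun x hx => ?_⟩
    split_ifs with hxi
    · rcases x with x | x <;> obtain rfl : x = i := hxi
      · exact h2
      · exact h3
    · exact spEmbedding_mulVec_apply_of_notMem _ _ _ (notMem_range_pairEmbedding hij hxi hx)
  have hA1 : ((A : Matrix (Idx g) (Idx g) ℤ) *ᵥ Pi.single (inr j) 1) (inr j) = 1 := by
    rw [mulVec_inr_of_fix hAj, Pi.single_eq_same]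
  obtain ⟨r, ⟨hr, hrj⟩, ⟨h1, -⟩, hclear⟩ := exists_mem_forall_clear _ _ T hj step
    ⟨hA1, fun x hx => dvd_mulVec_single_of_ne hA hx⟩
  obtain ⟨c, hc⟩ := two_mul_dvd_mulVec_single_inr (mul_mem hr.1.2 hA) j
  refine ⟨spEmbedding (pairEmbedding hi₀) (longTwo (upperUni (-(2 * (d : ℤ) ^ 2 * c)))) * r,
    mul_mem ⟨spEmbedding_mem_commGammaMod _ hd (longTwo_mem_commGammaMod hd (by lia) ?_ ?_ ?_),
      spEmbedding_longTwo_mem_fixOff hi₀ (by simp) _⟩ hr, ?_, ?_⟩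
  · simp [upperUni_apply]
  · simp [upperUni_apply]
  · simp [upperUni_apply]
  · rw [mul_assoc (spEmbedding _ _), coe_mul_mulVec, coe_mul_mulVec, hAj, mem_fixVec.mp hrj]
    obtain ⟨h1, h2, h3⟩ := spEmbedding_longTwo_mulVec hi₀ (upperUni (-(2 * (d : ℤ) ^ 2 * c)))
      (Pi.single (inl j) 1)
    ext x
    by_cases hxj : Sum.elim id id x = j
    · rcases x with x | x <;> obtain rfl : x = j := hxj
      · rw [h1]
        simp [upperUni_apply]
      · rw [h2]
        simp [upperUni_apply]
    · exact h3 x hxj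
  rw [mul_assoc (spEmbedding _ _), coe_mul_mulVec, coe_mul_mulVec]
  rw [coe_mul_mulVec] at hc
  obtain ⟨h2, h3, h4⟩ := spEmbedding_longTwo_mulVec hi₀ (upperUni (-(2 * (d : ℤ) ^ 2 * c)))
    ((r : Matrix (Idx g) (Idx g) ℤ) *ᵥ
      ((A : Matrix (Idx g) (Idx g) ℤ) *ᵥ Pi.single (inr j) 1))
  ext x
  by_cases hxj : Sum.elim id id x = j
  · rcases x with x | x <;> obtain rfl : x = j := hxj
    · rw [h2, h1, hc]
      simp [upperUni_apply]
    · rw [h3, h1, hc]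
      simp [upperUni_apply]
  · rw [h4 x hxj, hclear x hxj, Pi.single_eq_of_ne (by rintro rfl; exact hxj rfl)]
    split_ifs with hxT
    · rfl
    · rw [mulVec_apply_of_mem_fixOff hAT _ (by simp [hxj, hxT]),
        Pi.single_eq_of_ne (by rintro rfl; exact hxj rfl)]

lemma mem_commutator_of_mem_fixOff (hg : 2 ≤ g) (hd0 : 2 ≤ d) {h : Even (d ^ 2)}
    (T : Finset (Fin g)) {A : SpZ g} (hA : A ∈ GammaMod g (d ^ 2) h) (hAT : A ∈ fixOff T) :
    A ∈ ⁅Gamma g d, Gamma g d⁆ := by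
  have hd : Even d := (Nat.even_pow.mp h).1
  induction T using Finset.induction_on generalizing A with
  | empty =>
    rw [fixOff_empty, Subgroup.mem_bot] at hAT
    exact hAT ▸ one_mem _
  | insert j T hj ih =>
    obtain ⟨r, hr, h1⟩ := exists_fix_inl hd hg hd0 hj hA hAT
    obtain ⟨s, hs, h2, h3⟩ := exists_fix_inr hd hg hd0 hj (mul_mem hr.1.2 hA)
      (mul_mem hr.2 hAT) h1
    rw [← Subgroup.mul_mem_cancel_left _ hr.1.1, ← Subgroup.mul_mem_cancel_left _ hs.1.1]
    refine ih (mul_mem hs.1.2 (mul_mem hr.1.2 hA)) (mem_fixOff.mpr fun x hx => ?_)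
    by_cases hxj : Sum.elim id id x = j
    · rcases x with x | x <;> obtain rfl : x = j := hxj
      · exact h2
      · exact h3
    · exact mem_fixOff.mp (mul_mem hs.2 (mul_mem hr.2 hAT)) x (by simp [hx, hxj])

end Reduction

/-- Lemma 2.6: for even `d`, `Γ_g[d², 2d²] ⊆ [Γ_g[d], Γ_g[d]]`. -/
theorem GammaMod_le_commutator (g d : ℕ) (hg : 2 ≤ g) (hd : 2 ≤ d) (hdeven : Even d) :
    GammaMod g (d ^ 2) (by rw [pow_two]; exact hdeven.mul_right d)
      ≤ ⁅Gamma g d, Gamma g d⁆ := by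
  exact fun A hA => mem_commutator_of_mem_fixOff hg hd Finset.univ hA
    (mem_fixOff.mpr fun x hx => absurd (Finset.mem_univ _) hx)
end

section
/- (Igusa) Let g ≥ 1 and let d ≥ 2 be even. Then [Γ_g[d],Γ_g[d]] ⊆ Γ_g[d²,2d²], i.e. every commutator of two matrices in Γ_g[d] is congruent to the identity mod d² and the diagonal entries of the q- and r-blocks of its d²-part are even. -/
open Matrix

/-- An element of `Γ_g[d]` has the form `1 + d P` with `P` integral. -/
lemma exists_eq_one_add_smul_of_mem_Gamma {g d : ℕ} {A : ↥(SpZ g)} (hA : A ∈ Gamma g d) :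
    ∃ P : Matrix (Idx g) (Idx g) ℤ, (A : Matrix (Idx g) (Idx g) ℤ) = 1 + (d : ℤ) • P := by
  choose P hP using mem_Gamma_iff.mp hA
  refine ⟨Matrix.of P, ?_⟩
  ext i j
  simp only [Matrix.add_apply, Matrix.smul_apply, Matrix.of_apply, smul_eq_mul]
  linear_combination hP i j

/-- The infinitesimal symplectic relation satisfied by `P` when `1 + d P` is symplectic. -/
lemma mul_J_eq_of_one_add_smul_mem {g d : ℕ} (hd : d ≠ 0) {P : Matrix (Idx g) (Idx g) ℤ}
    (h : 1 + (d : ℤ) • P ∈ SpZ g) :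
    P * J (Fin g) ℤ = -(J (Fin g) ℤ * Pᵀ) - (d : ℤ) • (P * J (Fin g) ℤ * Pᵀ) := by
  rw [SymplecticGroup.mem_iff] at h
  simp only [transpose_add, transpose_one, transpose_smul, add_mul, mul_add, one_mul, mul_one,
    smul_mul_assoc, mul_smul_comm] at h
  have hd' : (d : ℤ) ≠ 0 := by exact_mod_cast hd
  refine smul_right_injective _ hd' ?_
  simp only [smul_sub, smul_neg]
  linear_combination (norm := module) h

/-- If `1 + d P` and `1 + d Q` are symplectic with `d` even, then the matrix `[P, Q] J` is
congruent mod 2 to a matrix of the form `T + Tᵀ`, hence has even diagonal. -/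
lemma two_dvd_commutator_mul_J_diag {g d : ℕ} (hd : d ≠ 0) (hdeven : Even d)
    {P Q : Matrix (Idx g) (Idx g) ℤ} (hP : 1 + (d : ℤ) • P ∈ SpZ g)
    (hQ : 1 + (d : ℤ) • Q ∈ SpZ g) (k : Idx g) :
    (2 : ℤ) ∣ ((P * Q - Q * P) * J (Fin g) ℤ) k k := by
  have hd2 : (2 : ℤ) ∣ d := by exact_mod_cast hdeven.two_dvd
  set T := Q * J (Fin g) ℤ * Pᵀ with hT
  have hTt : Tᵀ = -(P * J (Fin g) ℤ * Qᵀ) := by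
    simp [hT, transpose_mul, J_transpose, Matrix.mul_assoc]
  have key : (P * Q - Q * P) * J (Fin g) ℤ = T + Tᵀ +
      (d : ℤ) • (Q * (P * J (Fin g) ℤ * Pᵀ) - P * (Q * J (Fin g) ℤ * Qᵀ)) := by
    conv_lhs => rw [sub_mul, mul_assoc P Q, mul_assoc Q P, mul_J_eq_of_one_add_smul_mem hd hP,
      mul_J_eq_of_one_add_smul_mem hd hQ]
    rw [hTt, hT]
    simp only [mul_sub, sub_mul, mul_neg, neg_mul, mul_smul_comm, smul_mul_assoc, ← mul_assoc]
    module
  rw [key, Matrix.add_apply, Matrix.add_apply, transpose_apply, Matrix.smul_apply, smul_eq_mul, ← two_mul]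
  exact dvd_add (dvd_mul_right _ _) (hd2.mul_right _)

/-- The commutator of `1 + d P` and `1 + d Q` is `1 + d² ([P, Q] + d R)`. -/
lemma exists_commutator_eq {g d : ℕ} {A B : ↥(SpZ g)} (hA : A ∈ Gamma g d) (hB : B ∈ Gamma g d)
    {P Q : Matrix (Idx g) (Idx g) ℤ} (hP : (A : Matrix (Idx g) (Idx g) ℤ) = 1 + (d : ℤ) • P)
    (hQ : (B : Matrix (Idx g) (Idx g) ℤ) = 1 + (d : ℤ) • Q) :
    ∃ R : Matrix (Idx g) (Idx g) ℤ, ((A * B * A⁻¹ * B⁻¹ : ↥(SpZ g)) : Matrix (Idx g) (Idx g) ℤ) =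
      1 + ((d : ℤ) ^ 2) • (P * Q - Q * P + (d : ℤ) • R) := by
  obtain ⟨R, hR⟩ := exists_eq_one_add_smul_of_mem_Gamma (mul_mem (inv_mem hA) (inv_mem hB))
  refine ⟨(P * Q - Q * P) * R, ?_⟩
  have h1 : (B : Matrix (Idx g) (Idx g) ℤ) * A * (A⁻¹ * B⁻¹ : ↥(SpZ g)) = 1 := by
    rw [← Submonoid.coe_mul, ← Submonoid.coe_mul, ← Submonoid.coe_one]
    congr 1
    group
  have h2 : (A : Matrix (Idx g) (Idx g) ℤ) * B - B * A = ((d : ℤ) ^ 2) • (P * Q - Q * P) := by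
    rw [hP, hQ]
    simp only [add_mul, mul_add, one_mul, mul_one, smul_mul_assoc, mul_smul_comm]
    module
  calc ((A * B * A⁻¹ * B⁻¹ : ↥(SpZ g)) : Matrix (Idx g) (Idx g) ℤ)
      = (A : Matrix (Idx g) (Idx g) ℤ) * B * (A⁻¹ * B⁻¹ : ↥(SpZ g)) := by
        rw [← Submonoid.coe_mul, ← Submonoid.coe_mul, mul_assoc (A * B)]
    _ = 1 + ((A : Matrix (Idx g) (Idx g) ℤ) * B - B * A) * (A⁻¹ * B⁻¹ : ↥(SpZ g)) := by
        rw [sub_mul, h1]; abel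
    _ = _ := by
        rw [h2, hR]
        simp only [mul_add, mul_one, smul_mul_assoc, mul_smul_comm]
        module

/-- (Igusa) For even `d`, `[Γ_g[d], Γ_g[d]] ⊆ Γ_g[d², 2d²]`. -/
theorem commutator_le_GammaMod (g d : ℕ) (hg : 1 ≤ g) (hd : 2 ≤ d) (hdeven : Even d) :
    ⁅Gamma g d, Gamma g d⁆
      ≤ GammaMod g (d ^ 2) (by rw [pow_two]; exact hdeven.mul_right d) := by
  rw [Subgroup.commutator_le]
  intro A hA B hB
  rw [commutatorElement_def]
  have hd0 : d ≠ 0 := by omega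
  have hd2 : (2 : ℤ) ∣ d := by exact_mod_cast hdeven.two_dvd
  obtain ⟨P, hP⟩ := exists_eq_one_add_smul_of_mem_Gamma hA
  obtain ⟨Q, hQ⟩ := exists_eq_one_add_smul_of_mem_Gamma hB
  obtain ⟨R, hR⟩ := exists_commutator_eq hA hB hP hQ
  have hdiag := two_dvd_commutator_mul_J_diag hd0 hdeven (hP ▸ A.2) (hQ ▸ B.2)
  refine ⟨mem_Gamma_iff.mpr fun i j => ?_, fun i => ⟨?_, ?_⟩⟩
  · rw [hR, Matrix.add_apply, add_sub_cancel_left, Matrix.smul_apply, smul_eq_mul, Nat.cast_pow]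
    exact dvd_mul_right _ _
  · have h := hdiag (Sum.inl i)
    have e : ((P * Q - Q * P) * J (Fin g) ℤ) (Sum.inl i) (Sum.inl i)
        = (P * Q - Q * P) (Sum.inl i) (Sum.inr i) := by
      rw [mul_apply]
      simp [J, one_apply]
    rw [e] at h
    rw [hR, Matrix.add_apply, one_apply_ne Sum.inl_ne_inr, zero_add, Matrix.smul_apply, smul_eq_mul,
      Nat.cast_pow, mul_comm]
    refine mul_dvd_mul_left _ ?_
    rw [Matrix.add_apply, Matrix.smul_apply, smul_eq_mul]
    exact dvd_add h (hd2.mul_right _)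
  · have h := hdiag (Sum.inr i)
    have e : ((P * Q - Q * P) * J (Fin g) ℤ) (Sum.inr i) (Sum.inr i)
        = -(P * Q - Q * P) (Sum.inr i) (Sum.inl i) := by
      rw [mul_apply]
      simp [J, one_apply]
    rw [e, dvd_neg] at h
    rw [hR, Matrix.add_apply, one_apply_ne Sum.inr_ne_inl, zero_add, Matrix.smul_apply, smul_eq_mul,
      Nat.cast_pow, mul_comm]
    refine mul_dvd_mul_left _ ?_
    rw [Matrix.add_apply, Matrix.smul_apply, smul_eq_mul]
    exact dvd_add h (hd2.mul_right _)
end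

section
/- Let g ≥ 1 and d ≥ 1. For A, B ∈ Γ_g[d], write A = I + dA' and B = I + dB' with A', B' integral matrices. Then every entry of the matrix A·B·A⁻¹·B⁻¹ − (I + d²(A'B' − B'A')) is divisible by d³; i.e. ABA⁻¹B⁻¹ ≡ I + d²(A'B' − B'A') mod d³. -/
open Matrix

/-- The exact error term in the second-order expansion of the commutator of `1 + dx` and `1 + dy`,
where `p` is the inverse of `(1 + dy)(1 + dx)`. -/
lemma commutator_sub_expansion {R : Type*} [Ring R] (d : ℤ) {a b x y p : R}
    (ha : a = 1 + d • x) (hb : b = 1 + d • y) (hl : p * (b * a) = 1) (hr : b * a * p = 1) :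
    a * b * p - (1 + d ^ 2 • (x * y - y * x)) =
      d ^ 3 • -((x * y - y * x) * (p * (x + y + d • (y * x)))) := by
  have hab : a * b = b * a + d ^ 2 • (x * y - y * x) := by
    subst ha hb
    simp only [mul_add, add_mul, mul_one, one_mul, smul_mul_assoc, mul_smul_comm]
    module
  have hba : b * a = 1 + d • (x + y + d • (y * x)) := by
    subst ha hb
    simp only [mul_add, add_mul, mul_one, one_mul, smul_mul_assoc, mul_smul_comm]
    module
  have hp : p = 1 - d • (p * (x + y + d • (y * x))) := by
    rw [eq_sub_iff_add_eq, ← mul_smul_comm]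
    rwa [hba, mul_add, mul_one] at hl
  rw [hab, add_mul, hr, smul_mul_assoc]
  generalize p * (x + y + d • (y * x)) = q at hp ⊢
  rw [hp, mul_sub, mul_one, mul_smul_comm]
  module

/-- For `A = I + dA'`, `B = I + dB'` in `Γ_g[d]`, the commutator satisfies
`ABA⁻¹B⁻¹ ≡ I + d²(A'B' − B'A') mod d³`, entrywise. -/
theorem commutator_congruence (g d : ℕ) (hg : 1 ≤ g) (hd : 1 ≤ d) (A B : ↥(SpZ g))
    (hA : A ∈ Gamma g d) (hB : B ∈ Gamma g d) (A' B' : Matrix (Idx g) (Idx g) ℤ)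
    (hA' : (A : Matrix (Idx g) (Idx g) ℤ) = 1 + (d : ℤ) • A')
    (hB' : (B : Matrix (Idx g) (Idx g) ℤ) = 1 + (d : ℤ) • B') :
    ∀ i j : Idx g, ((d : ℤ)) ^ 3 ∣
      (((A * B * A⁻¹ * B⁻¹ : ↥(SpZ g)) : Matrix (Idx g) (Idx g) ℤ) i j
        - ((1 : Matrix (Idx g) (Idx g) ℤ) + ((d : ℤ)) ^ 2 • (A' * B' - B' * A')) i j) := by
  intro i j
  have h : A * B * A⁻¹ * B⁻¹ = A * B * (B * A)⁻¹ := by group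
  have key := commutator_sub_expansion (d : ℤ) hA' hB'
    (congrArg Subtype.val (inv_mul_cancel (B * A))) (congrArg Subtype.val (mul_inv_cancel (B * A)))
  rw [← Matrix.sub_apply, h]
  exact ⟨_, congrFun (congrFun key i) j⟩
end
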